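/- Suppose Condition (C) holds, ρ_k = 1 − 3r_k + O(r_k²) as k → ∞, and 0 ≤ β < 1. For n ≥ 2 let S_n = #{k ∈ [2,n] : k is a cutpoint of X}. Then there exist constants 0 < c₃ < c₄ < ∞ such that c₃ ≤ liminf_{n→∞} E S_n/(log n · (log log n)^{−β}) ≤ limsup_{n→∞} E S_n/(log n · (log log n)^{−β}) ≤ c₄, and for each ε > 0, almost surely lim_{n→∞} S_n/((log n)^{1+ε}(log log n)^{−β}) = 0. -/

import Mathlib

open Filter MeasureTheory ENNReal Topology Asymptotics

noncomputable section

/-- Transition function of the (2,1) random walk `X`. -/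
def transX (q p1 p2 : ℕ → ℝ) (n j : ℕ) : ℝ :=
  if n = 0 then (if j = 1 then 1 else 0)
  else if n = 1 then (if j = 2 then 1 else 0)
  else if j = n + 1 then q n
  else if j = n - 1 then p1 n
  else if j = n - 2 then p2 n
  else 0

/-- `μ` is the law (on path space) of the time-homogeneous Markov chain on `ℕ`
with one-step transition probabilities `p` and initial state `init`. -/
def IsMarkovChain (μ : Measure (ℕ → ℕ)) (p : ℕ → ℕ → ℝ) (init : ℕ) : Prop :=
  μ {ω | ω 0 = init} = 1 ∧
  ∀ (k : ℕ) (x : ℕ → ℕ) (j : ℕ),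
    μ {ω | (∀ i ≤ k, ω i = x i) ∧ ω (k + 1) = j}
      = ENNReal.ofReal (p (x k) j) * μ {ω | ∀ i ≤ k, ω i = x i}

/-- `ρ_k`, the spectral radius of the matrix `A_k`. -/
def rho (q p1 p2 : ℕ → ℝ) (k : ℕ) : ℝ :=
  ((p1 k + p2 k) / q k
    + Real.sqrt (((p1 k + p2 k) / q k) ^ 2 + 4 * (p2 k / q k))) / 2

/-- The perturbation `r_n = (1/3)(1/n + 1/(n (log log n)^β))` for `n ≥ 4`,
and `r_2 = r_3 = r_4`. -/
def rseq (β : ℝ) (n : ℕ) : ℝ :=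
  if 4 ≤ n then
    (1 / 3) * (1 / (n : ℝ) + 1 / ((n : ℝ) * Real.log (Real.log (n : ℝ)) ^ β))
  else
    (1 / 3) * (1 / (4 : ℝ) + 1 / ((4 : ℝ) * Real.log (Real.log (4 : ℝ)) ^ β))

/-- `S_n(ω)`: the number of cutpoints of the (2,1) walk lying in `[2,n]`;
a site `k` is a cutpoint when it is visited exactly once. -/
def SX (ω : ℕ → ℕ) (n : ℕ) : ℕ :=
  {k : ℕ | 2 ≤ k ∧ k ≤ n ∧ (∃! m, ω m = k)}.ncard


/-- one-step operator of the walk -/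
def Pop (q p1 p2 : ℕ → ℝ) (f : ℕ → ℝ) (x : ℕ) : ℝ :=
  if x = 0 then f 1 else if x = 1 then f 2
  else q x * f (x + 1) + p1 x * f (x - 1) + p2 x * f (x - 2)

/-- probability of avoiding `k` for times `0..l` starting from `x` -/
def wr (q p1 p2 : ℕ → ℝ) (k : ℕ) : ℕ → ℕ → ℝ
  | 0, x => if x = k then 0 else 1
  | l + 1, x => if x = k then 0 else Pop q p1 p2 (wr q p1 p2 k l) x

lemma Pop_nonneg {q p1 p2 : ℕ → ℝ}
    (hq : ∀ k, 2 ≤ k → 0 < q k) (hp1 : ∀ k, 2 ≤ k → 0 ≤ p1 k)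
    (hp2 : ∀ k, 2 ≤ k → 0 < p2 k) {f : ℕ → ℝ} (hf : ∀ x, 0 ≤ f x) (x : ℕ) :
    0 ≤ Pop q p1 p2 f x := by
  unfold Pop
  split_ifs with h0 h1
  · exact hf _
  · exact hf _
  · have h2 : 2 ≤ x := by omega
    have := hq x h2; have := hp1 x h2; have := hp2 x h2
    have := hf (x+1); have := hf (x-1); have := hf (x-2)
    positivity

lemma Pop_mono {q p1 p2 : ℕ → ℝ}
    (hq : ∀ k, 2 ≤ k → 0 < q k) (hp1 : ∀ k, 2 ≤ k → 0 ≤ p1 k)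
    (hp2 : ∀ k, 2 ≤ k → 0 < p2 k) {f g : ℕ → ℝ} (hf : ∀ x, f x ≤ g x) (x : ℕ) :
    Pop q p1 p2 f x ≤ Pop q p1 p2 g x := by
  unfold Pop
  split_ifs with h0 h1
  · exact hf _
  · exact hf _
  · have h2 : 2 ≤ x := by omega
    have a1 := hq x h2; have a2 := hp1 x h2; have a3 := hp2 x h2
    have := mul_le_mul_of_nonneg_left (hf (x+1)) a1.le
    have := mul_le_mul_of_nonneg_left (hf (x-1)) a2
    have := mul_le_mul_of_nonneg_left (hf (x-2)) a3.le
    linarith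

lemma tsum_transX {q p1 p2 : ℕ → ℝ}
    (hq : ∀ k, 2 ≤ k → 0 < q k) (hp1 : ∀ k, 2 ≤ k → 0 ≤ p1 k)
    (hp2 : ∀ k, 2 ≤ k → 0 < p2 k) {f : ℕ → ℝ} (hf : ∀ x, 0 ≤ f x) (x : ℕ) :
    ∑' j, ENNReal.ofReal (transX q p1 p2 x j) * ENNReal.ofReal (f j)
      = ENNReal.ofReal (Pop q p1 p2 f x) := by
  by_cases h0 : x = 0
  · subst h0
    rw [tsum_eq_single 1]
    · simp [transX, Pop]
    · intro j hj; simp [transX, hj]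
  by_cases h1 : x = 1
  · subst h1
    rw [tsum_eq_single 2]
    · simp [transX, Pop]
    · intro j hj; simp [transX, hj]
  have h2 : 2 ≤ x := by omega
  have a1 := hq x h2; have a2 := hp1 x h2; have a3 := hp2 x h2
  rw [tsum_eq_sum (s := {x + 1, x - 1, x - 2})]
  · rw [Finset.sum_insert, Finset.sum_insert, Finset.sum_singleton]
    · have e1 : transX q p1 p2 x (x+1) = q x := by simp [transX, h0, h1]
      have e2 : transX q p1 p2 x (x-1) = p1 x := by
        have : x - 1 ≠ x + 1 := by omega
        simp [transX, h0, h1, this]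
      have e3 : transX q p1 p2 x (x-2) = p2 x := by
        have : x - 2 ≠ x + 1 := by omega
        have : x - 2 ≠ x - 1 := by omega
        simp [transX, *]
      rw [e1, e2, e3]
      have := hf (x+1); have := hf (x-1); have := hf (x-2)
      rw [← ENNReal.ofReal_mul a1.le, ← ENNReal.ofReal_mul a2, ← ENNReal.ofReal_mul a3.le,
        ← ENNReal.ofReal_add (by positivity) (by positivity),
        ← ENNReal.ofReal_add (by positivity) (by positivity)]
      simp [Pop, h0, h1, add_assoc]
    · simp; omega
    · simp; omega
  · intro j hj
    simp only [Finset.mem_insert, Finset.mem_singleton, not_or] at hj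
    simp [transX, h0, h1, hj]

section surv
variable {q p1 p2 : ℕ → ℝ}

lemma wr_nonneg (hq : ∀ k, 2 ≤ k → 0 < q k) (hp1 : ∀ k, 2 ≤ k → 0 ≤ p1 k)
    (hp2 : ∀ k, 2 ≤ k → 0 < p2 k) (k l x : ℕ) : 0 ≤ wr q p1 p2 k l x := by
  induction l generalizing x with
  | zero => unfold wr; split_ifs <;> norm_num
  | succ l ih =>
    unfold wr; split_ifs
    · exact le_rfl
    · exact Pop_nonneg hq hp1 hp2 ih x

lemma wr_anti (hq : ∀ k, 2 ≤ k → 0 < q k) (hp1 : ∀ k, 2 ≤ k → 0 ≤ p1 k)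
    (hp2 : ∀ k, 2 ≤ k → 0 < p2 k) (hsum : ∀ k, 2 ≤ k → q k + p1 k + p2 k = 1)
    (k l x : ℕ) : wr q p1 p2 k (l+1) x ≤ wr q p1 p2 k l x := by
  induction l generalizing x with
  | zero =>
    unfold wr; split_ifs with h
    · exact le_rfl
    · refine (Pop_mono hq hp1 hp2 (g := fun _ => 1) ?_ x).trans ?_
      · intro y; unfold wr; split_ifs <;> norm_num
      · unfold Pop; split_ifs
        · exact le_rfl
        · exact le_rfl
        · have := hsum x (by omega); linarith
  | succ l ih =>
    rw [wr, wr]; split_ifs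
    · exact le_rfl
    · exact Pop_mono hq hp1 hp2 ih x

lemma wr_le_one (hq : ∀ k, 2 ≤ k → 0 < q k) (hp1 : ∀ k, 2 ≤ k → 0 ≤ p1 k)
    (hp2 : ∀ k, 2 ≤ k → 0 < p2 k) (hsum : ∀ k, 2 ≤ k → q k + p1 k + p2 k = 1)
    (k l x : ℕ) : wr q p1 p2 k l x ≤ 1 := by
  induction l with
  | zero => unfold wr; split_ifs <;> norm_num
  | succ l ih => exact (wr_anti hq hp1 hp2 hsum k l x).trans ih

/-- limit avoidance probability -/
def wlim (q p1 p2 : ℕ → ℝ) (k x : ℕ) : ℝ := ⨅ l, wr q p1 p2 k l x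

lemma wr_tendsto (hq : ∀ k, 2 ≤ k → 0 < q k) (hp1 : ∀ k, 2 ≤ k → 0 ≤ p1 k)
    (hp2 : ∀ k, 2 ≤ k → 0 < p2 k) (hsum : ∀ k, 2 ≤ k → q k + p1 k + p2 k = 1)
    (k x : ℕ) : Tendsto (fun l => wr q p1 p2 k l x) atTop (𝓝 (wlim q p1 p2 k x)) := by
  apply tendsto_atTop_ciInf
  · exact antitone_nat_of_succ_le (fun l => wr_anti hq hp1 hp2 hsum k l x)
  · refine ⟨0, ?_⟩
    rintro _ ⟨l, rfl⟩
    exact wr_nonneg hq hp1 hp2 k l x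

lemma Pop_tendsto {f : ℕ → ℕ → ℝ} {g : ℕ → ℝ}
    (h : ∀ x, Tendsto (fun l => f l x) atTop (𝓝 (g x))) (x : ℕ) :
    Tendsto (fun l => Pop q p1 p2 (f l) x) atTop (𝓝 (Pop q p1 p2 g x)) := by
  unfold Pop
  split_ifs
  · exact h _
  · exact h _
  · exact (((h _).const_mul _).add ((h _).const_mul _)).add ((h _).const_mul _)

lemma wlim_self (k : ℕ) : wlim q p1 p2 k k = 0 := by
  have : ∀ l, wr q p1 p2 k l k = 0 := by intro l; cases l <;> simp [wr]
  simp [wlim, this]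

lemma wlim_harm (hq : ∀ k, 2 ≤ k → 0 < q k) (hp1 : ∀ k, 2 ≤ k → 0 ≤ p1 k)
    (hp2 : ∀ k, 2 ≤ k → 0 < p2 k) (hsum : ∀ k, 2 ≤ k → q k + p1 k + p2 k = 1)
    (k x : ℕ) (hx : x ≠ k) : wlim q p1 p2 k x = Pop q p1 p2 (wlim q p1 p2 k) x := by
  have h1 := (tendsto_add_atTop_iff_nat 1).2 (wr_tendsto hq hp1 hp2 hsum k x)
  have h2 := Pop_tendsto (q := q) (p1 := p1) (p2 := p2) (wr_tendsto hq hp1 hp2 hsum k) x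
  refine tendsto_nhds_unique h1 (h2.congr ?_)
  intro l; rw [wr, if_neg hx]

lemma wlim_le_one (hq : ∀ k, 2 ≤ k → 0 < q k) (hp1 : ∀ k, 2 ≤ k → 0 ≤ p1 k)
    (hp2 : ∀ k, 2 ≤ k → 0 < p2 k) (hsum : ∀ k, 2 ≤ k → q k + p1 k + p2 k = 1)
    (k x : ℕ) : wlim q p1 p2 k x ≤ 1 :=
  le_of_tendsto' (wr_tendsto hq hp1 hp2 hsum k x) (fun l => wr_le_one hq hp1 hp2 hsum k l x)

lemma wlim_nonneg (hq : ∀ k, 2 ≤ k → 0 < q k) (hp1 : ∀ k, 2 ≤ k → 0 ≤ p1 k)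
    (hp2 : ∀ k, 2 ≤ k → 0 < p2 k) (hsum : ∀ k, 2 ≤ k → q k + p1 k + p2 k = 1)
    (k x : ℕ) : 0 ≤ wlim q p1 p2 k x :=
  ge_of_tendsto' (wr_tendsto hq hp1 hp2 hsum k x) (fun l => wr_nonneg hq hp1 hp2 k l x)

lemma wlim_low (hq : ∀ k, 2 ≤ k → 0 < q k) (hp1 : ∀ k, 2 ≤ k → 0 ≤ p1 k)
    (hp2 : ∀ k, 2 ≤ k → 0 < p2 k) (hsum : ∀ k, 2 ≤ k → q k + p1 k + p2 k = 1)
    (k : ℕ) (x : ℕ) (hx : x ≤ k) : wlim q p1 p2 k x = 0 := by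
  set w := wlim q p1 p2 k with hw
  have key : ∀ y, y ≤ k → w y = w 0 := by
    intro y
    induction y using Nat.strong_induction_on with
    | _ y ih =>
      intro hy
      rcases y with _ | _ | _ | y
      · rfl
      · have := wlim_harm hq hp1 hp2 hsum k 0 (by omega)
        simp only [Pop, if_true] at this; exact this.symm
      · have := wlim_harm hq hp1 hp2 hsum k 1 (by omega)
        simp [Pop] at this
        rw [← ih 1 (by omega) (by omega)]; exact this.symm
      · have h := wlim_harm hq hp1 hp2 hsum k (y+2) (by omega)
        simp [Pop] at h
        rw [← hw, ih (y+2) (by omega) (by omega), ih (y+1) (by omega) (by omega),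
          ih y (by omega) (by omega)] at h
        have hs := hsum (y+2) (by omega)
        have hq' := hq (y+2) (by omega)
        have : q (y+2) * (w (y+2+1) - w 0) = 0 := by
          have : p1 (y+2) = 1 - q (y+2) - p2 (y+2) := by linarith
          rw [this] at h; linarith
        rcases mul_eq_zero.1 this with h | h
        · exact absurd h hq'.ne'
        · linarith
  rw [key x hx, ← key k le_rfl]; exact wlim_self k

/-- increments of the harmonic function -/
def dseq (q p1 p2 : ℕ → ℝ) (k : ℕ) : ℕ → ℝ
  | 0 => 1
  | 1 => (p1 (k+1) + p2 (k+1)) / q (k+1)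
  | i + 2 => (p1 (k+i+2) + p2 (k+i+2)) / q (k+i+2) * dseq q p1 p2 k (i+1)
      + p2 (k+i+2) / q (k+i+2) * dseq q p1 p2 k i

lemma dseq_nonneg (hq : ∀ k, 2 ≤ k → 0 < q k) (hp1 : ∀ k, 2 ≤ k → 0 ≤ p1 k)
    (hp2 : ∀ k, 2 ≤ k → 0 < p2 k) (k : ℕ) (hk : 2 ≤ k) (i : ℕ) : 0 ≤ dseq q p1 p2 k i := by
  induction i using Nat.strong_induction_on with
  | _ i ih =>
    rcases i with _ | _ | i
    · simp [dseq]
    · have := hq (k+1) (by omega); have := hp1 (k+1) (by omega); have := hp2 (k+1) (by omega)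
      simp only [dseq]; positivity
    · have := hq (k+i+2) (by omega); have := hp1 (k+i+2) (by omega)
      have := hp2 (k+i+2) (by omega)
      have := ih i (by omega); have := ih (i+1) (by omega)
      simp only [dseq]; positivity

lemma wlim_incr (hq : ∀ k, 2 ≤ k → 0 < q k) (hp1 : ∀ k, 2 ≤ k → 0 ≤ p1 k)
    (hp2 : ∀ k, 2 ≤ k → 0 < p2 k) (hsum : ∀ k, 2 ≤ k → q k + p1 k + p2 k = 1)
    (k : ℕ) (hk : 2 ≤ k) (i : ℕ) :
    wlim q p1 p2 k (k+i+1) - wlim q p1 p2 k (k+i)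
      = wlim q p1 p2 k (k+1) * dseq q p1 p2 k i := by
  induction i using Nat.strong_induction_on with
  | _ i ih =>
    rcases i with _ | _ | i
    · simp [dseq, wlim_self]
    · have h := wlim_harm hq hp1 hp2 hsum k (k+1) (by omega)
      have e1 : k + 1 ≠ 0 := by omega
      have e2 : k ≠ 0 := by omega
      simp [Pop, e2] at h
      rw [wlim_self, wlim_low hq hp1 hp2 hsum k (k-1) (by omega)] at h
      have hq' := hq (k+1) (by omega)
      have hs := hsum (k+1) (by omega)
      simp only [dseq, zero_add]
      have hpp : p1 (k+1) + p2 (k+1) = 1 - q (k+1) := by linarith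
      rw [hpp]
      field_simp
      linarith
    · have h := wlim_harm hq hp1 hp2 hsum k (k+i+2) (by omega)
      simp [Pop] at h
      have h1 := ih i (by omega)
      have h2 := ih (i+1) (by omega)
      have hq' := hq (k+i+2) (by omega)
      have hs := hsum (k+i+2) (by omega)
      simp only [dseq]
      rw [show k + (i+1) + 1 = k+i+2 by ring, show k+(i+1) = k+i+1 by ring] at h2
      rw [show k + (i+1+1) + 1 = k+i+2+1 by ring, show k+(i+1+1) = k+i+2 by ring]
      have : wlim q p1 p2 k (k+1) * ((p1 (k+i+2) + p2 (k+i+2)) / q (k+i+2) * dseq q p1 p2 k (i+1)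
        + p2 (k+i+2) / q (k+i+2) * dseq q p1 p2 k i)
        = (p1 (k+i+2) + p2 (k+i+2)) / q (k+i+2) * (wlim q p1 p2 k (k+1) * dseq q p1 p2 k (i+1))
          + p2 (k+i+2) / q (k+i+2) * (wlim q p1 p2 k (k+1) * dseq q p1 p2 k i) := by ring
      rw [this, ← h1, ← h2]
      have hp : p1 (k+i+2) = 1 - q (k+i+2) - p2 (k+i+2) := by linarith
      rw [hp] at h ⊢
      field_simp
      linarith

lemma wlim_eq (hq : ∀ k, 2 ≤ k → 0 < q k) (hp1 : ∀ k, 2 ≤ k → 0 ≤ p1 k)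
    (hp2 : ∀ k, 2 ≤ k → 0 < p2 k) (hsum : ∀ k, 2 ≤ k → q k + p1 k + p2 k = 1)
    (k : ℕ) (hk : 2 ≤ k) (i : ℕ) :
    wlim q p1 p2 k (k+i)
      = wlim q p1 p2 k (k+1) * ∑ j ∈ Finset.range i, dseq q p1 p2 k j := by
  induction i with
  | zero => simp [wlim_self]
  | succ i ih =>
    rw [Finset.sum_range_succ, mul_add, ← ih, ← wlim_incr hq hp1 hp2 hsum k hk i]
    ring_nf

lemma wlim_upper (hq : ∀ k, 2 ≤ k → 0 < q k) (hp1 : ∀ k, 2 ≤ k → 0 ≤ p1 k)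
    (hp2 : ∀ k, 2 ≤ k → 0 < p2 k) (hsum : ∀ k, 2 ≤ k → q k + p1 k + p2 k = 1)
    (k : ℕ) (hk : 2 ≤ k) (i : ℕ) (M : ℝ) (hM : 0 < M)
    (h : M ≤ ∑ j ∈ Finset.range i, dseq q p1 p2 k j) :
    wlim q p1 p2 k (k+1) ≤ 1 / M := by
  have h1 := wlim_eq hq hp1 hp2 hsum k hk i
  have h2 := wlim_le_one hq hp1 hp2 hsum k (k+i)
  have h3 := wlim_nonneg hq hp1 hp2 hsum k (k+1)
  rw [le_div_iff₀ hM]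
  nlinarith

lemma wlim_lower (hq : ∀ k, 2 ≤ k → 0 < q k) (hp1 : ∀ k, 2 ≤ k → 0 ≤ p1 k)
    (hp2 : ∀ k, 2 ≤ k → 0 < p2 k) (hsum : ∀ k, 2 ≤ k → q k + p1 k + p2 k = 1)
    (k : ℕ) (hk : 2 ≤ k) (M : ℝ) (hM : 0 < M)
    (h : ∀ i, ∑ j ∈ Finset.range i, dseq q p1 p2 k j ≤ M) :
    1 / M ≤ wlim q p1 p2 k (k+1) := by
  set S : ℕ → ℝ := fun i => ∑ j ∈ Finset.range i, dseq q p1 p2 k j with hS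
  have hS0 : ∀ i, 0 ≤ S i := fun i =>
    Finset.sum_nonneg (fun j _ => dseq_nonneg hq hp1 hp2 k hk j)
  have hSs : ∀ i, S (i+1) = S i + dseq q p1 p2 k i := fun i => Finset.sum_range_succ _ _
  -- harmonicity of S
  have harm : ∀ i, S (i+1) ≤ Pop q p1 p2 (fun x => S (x - k)) (k+i+1) := by
    intro i
    have hq' := hq (k+i+1) (by omega)
    have hs := hsum (k+i+1) (by omega)
    have n0 : k + i + 1 ≠ 0 := by omega
    have n1 : k + i + 1 ≠ 1 := by omega
    simp only [Pop, if_neg n0, if_neg n1]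
    rw [show k+i+1+1-k = i+2 by omega, show k+i+1-1-k = i by omega,
      show k+i+1-2-k = i-1 by omega]
    rcases i with _ | i
    · have hd : dseq q p1 p2 k 1 = (p1 (k+1) + p2 (k+1)) / q (k+1) := by simp [dseq]
      have hd' : q (k+1) * dseq q p1 p2 k 1 = p1 (k+1) + p2 (k+1) := by
        rw [hd]; field_simp
      have e0 : S 0 = 0 := by simp [hS]
      have e1 : S 1 = 1 := by simp [hS, dseq]
      have e2 : S 2 = 1 + dseq q p1 p2 k 1 := by rw [hSs 1, e1]
      simp only [zero_add, add_zero, Nat.zero_sub] at *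
      rw [e0, e1, e2]
      linarith
    · have hq' := hq (k+i+2) (by omega)
      have hd : dseq q p1 p2 k (i+2) = (p1 (k+i+2) + p2 (k+i+2)) / q (k+i+2) * dseq q p1 p2 k (i+1)
        + p2 (k+i+2) / q (k+i+2) * dseq q p1 p2 k i := by simp [dseq]
      have hd' : q (k+i+2) * dseq q p1 p2 k (i+2)
          = (p1 (k+i+2) + p2 (k+i+2)) * dseq q p1 p2 k (i+1) + p2 (k+i+2) * dseq q p1 p2 k i := by
        rw [hd]; field_simp
      rw [show k + (i+1) + 1 = k+i+2 by ring] at *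
      rw [show i + 1 - 1 = i by omega, show i+1+2 = i+2+1 by ring, show i+1+1=i+2 by ring,
        hSs (i+2), show S (i+2) = S (i+1) + _ from hSs (i+1), hSs i]
      have hp : q (k+i+2) = 1 - p1 (k+i+2) - p2 (k+i+2) := by linarith
      rw [hp] at hd' ⊢
      linarith
  have hg : ∀ l x, S (x - k) / M ≤ wr q p1 p2 k l x := by
    intro l
    induction l with
    | zero =>
      intro x
      unfold wr
      split_ifs with hx
      · subst hx; simp [hS]
      · rw [div_le_one hM]; exact h _
    | succ l ih =>
      intro x
      by_cases hx : x ≤ k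
      · rw [Nat.sub_eq_zero_of_le hx]
        simp only [hS, Finset.range_zero, Finset.sum_empty, zero_div]
        exact wr_nonneg hq hp1 hp2 k (l+1) x
      · obtain ⟨i, rfl⟩ : ∃ i, x = k + i + 1 := ⟨x - k - 1, by omega⟩
        rw [wr, if_neg (by omega)]
        refine le_trans ?_ (Pop_mono hq hp1 hp2 ih _)
        have h1 := harm i
        have n0 : k + i + 1 ≠ 0 := by omega
        have n1 : k + i + 1 ≠ 1 := by omega
        simp only [Pop, if_neg n0, if_neg n1] at h1 ⊢
        rw [show k+i+1-k = i+1 by omega, div_le_iff₀ hM]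
        refine h1.trans (le_of_eq ?_)
        field_simp
  refine ge_of_tendsto' (wr_tendsto hq hp1 hp2 hsum k (k+1)) (fun l => ?_)
  have := hg l (k+1)
  simpa [hS, dseq] using this

end surv

section prob
variable {q p1 p2 : ℕ → ℝ} {μ : Measure (ℕ → ℕ)}

/-- `B` is determined by the first `m+1` coordinates -/
def DetBy (m : ℕ) (B : Set (ℕ → ℕ)) : Prop :=
  ∀ ω ω' : ℕ → ℕ, (∀ i ≤ m, ω i = ω' i) → ω ∈ B → ω' ∈ B

lemma meas_coord (i x : ℕ) : MeasurableSet {ω : ℕ → ℕ | ω i = x} := by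
  have h : Measurable (fun ω : ℕ → ℕ => ω i) := measurable_pi_apply i
  exact h (measurableSet_singleton x)

lemma meas_ne (i x : ℕ) : MeasurableSet {ω : ℕ → ℕ | ω i ≠ x} :=
  (meas_coord i x).compl

lemma meas_cyl (m : ℕ) (x : ℕ → ℕ) : MeasurableSet {ω : ℕ → ℕ | ∀ i ≤ m, ω i = x i} := by
  have : {ω : ℕ → ℕ | ∀ i ≤ m, ω i = x i} = ⋂ i, ⋂ (_ : i ≤ m), {ω | ω i = x i} := by
    ext ω; simp
  rw [this]
  exact MeasurableSet.iInter fun i => MeasurableSet.iInter fun _ => meas_coord _ _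

lemma DetBy.eq_iUnion {m : ℕ} {B : Set (ℕ → ℕ)} (hB : DetBy m B) :
    B = ⋃ y : {y : Fin (m+1) → ℕ | (fun i => if h : i < m + 1 then y ⟨i, h⟩ else 0) ∈ B},
      {ω : ℕ → ℕ | ∀ i ≤ m, ω i = (if h : i < m + 1 then y.1 ⟨i, h⟩ else 0)} := by
  ext ω
  simp only [Set.mem_iUnion, Set.mem_ofPred_eq]
  constructor
  · intro hω
    refine ⟨⟨fun i => ω i, ?_⟩, ?_⟩
    · refine hB ω _ ?_ hω
      intro i hi
      have : i < m + 1 := by omega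
      simp [this]
    · intro i hi
      have : i < m + 1 := by omega
      simp [this]
  · rintro ⟨⟨y, hy⟩, h⟩
    exact hB _ _ (fun i hi => (h i hi).symm) hy

lemma DetBy.measurableSet {m : ℕ} {B : Set (ℕ → ℕ)} (hB : DetBy m B) :
    MeasurableSet B := by
  rw [hB.eq_iUnion]
  exact MeasurableSet.iUnion fun y => meas_cyl m _

lemma one_step {p : ℕ → ℕ → ℝ} {s : ℕ} (hμ : IsMarkovChain μ p s) {m x : ℕ}
    {B : Set (ℕ → ℕ)} (hB : DetBy m B) (hx : ∀ ω ∈ B, ω m = x) (j : ℕ) :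
    μ (B ∩ {ω | ω (m+1) = j}) = ENNReal.ofReal (p x j) * μ B := by
  have hU := hB.eq_iUnion
  set I := {y : Fin (m+1) → ℕ | (fun i => if h : i < m + 1 then y ⟨i, h⟩ else 0) ∈ B} with hI
  set c : I → Set (ℕ → ℕ) := fun y =>
    {ω : ℕ → ℕ | ∀ i ≤ m, ω i = (if h : i < m + 1 then y.1 ⟨i, h⟩ else 0)} with hc
  have hdisj : Pairwise (Function.onFun Disjoint c) := by
    intro y z hyz
    rw [Function.onFun, Set.disjoint_left]
    intro ω h1 h2
    apply hyz
    ext i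
    have a1 := h1 i.1 (by omega)
    have a2 := h2 i.1 (by omega)
    have : i.1 < m + 1 := i.2
    simp only [this, dif_pos, Fin.eta] at a1 a2
    omega
  have h1 : μ B = ∑' y, μ (c y) := by
    conv_lhs => rw [hU]
    exact measure_iUnion hdisj (fun y => meas_cyl m _)
  have h2 : μ (B ∩ {ω | ω (m+1) = j}) = ∑' y, μ (c y ∩ {ω | ω (m+1) = j}) := by
    conv_lhs => rw [hU, Set.iUnion_inter]
    refine measure_iUnion ?_ (fun y => (meas_cyl m _).inter (meas_coord _ _))
    intro y z hyz
    exact (hdisj hyz).mono Set.inter_subset_left Set.inter_subset_left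
  rw [h1, h2, ← ENNReal.tsum_mul_left]
  congr 1
  ext y
  have h3 := hμ.2 m (fun i => if h : i < m + 1 then y.1 ⟨i, h⟩ else 0) j
  have h4 := hx _ y.2
  rw [h4] at h3
  exact h3

lemma surv (hq : ∀ k, 2 ≤ k → 0 < q k) (hp1 : ∀ k, 2 ≤ k → 0 ≤ p1 k)
    (hp2 : ∀ k, 2 ≤ k → 0 < p2 k) {s : ℕ} (hμ : IsMarkovChain μ (transX q p1 p2) s)
    (k l : ℕ) : ∀ (m x : ℕ) (B : Set (ℕ → ℕ)), DetBy m B → (∀ ω ∈ B, ω m = x) →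
      μ (B ∩ {ω | ∀ i ≤ l, ω (m+i) ≠ k}) = ENNReal.ofReal (wr q p1 p2 k l x) * μ B := by
  induction l with
  | zero =>
    intro m x B hB hx
    by_cases h : x = k
    · have : B ∩ {ω | ∀ i ≤ 0, ω (m+i) ≠ k} = ∅ := by
        ext ω
        simp only [Set.mem_inter_iff, Set.mem_ofPred_eq, Set.mem_empty_iff_false, iff_false, not_and]
        intro hω h'
        exact h' 0 le_rfl ((hx ω hω).trans h)
      rw [this]; simp [wr, h]
    · have : B ∩ {ω | ∀ i ≤ 0, ω (m+i) ≠ k} = B := by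
        apply Set.inter_eq_left.2
        intro ω hω i hi
        obtain rfl : i = 0 := by omega
        rw [add_zero, hx ω hω]; exact h
      rw [this]; simp [wr, h]
  | succ l ih =>
    intro m x B hB hx
    by_cases h : x = k
    · have : B ∩ {ω | ∀ i ≤ l+1, ω (m+i) ≠ k} = ∅ := by
        ext ω
        simp only [Set.mem_inter_iff, Set.mem_ofPred_eq, Set.mem_empty_iff_false, iff_false, not_and]
        intro hω h'
        exact h' 0 (by omega) ((hx ω hω).trans h)
      rw [this]; simp [wr, h]
    · have e : B ∩ {ω | ∀ i ≤ l+1, ω (m+i) ≠ k}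
          = ⋃ j, ((B ∩ {ω | ω (m+1) = j}) ∩ {ω | ∀ i ≤ l, ω (m+1+i) ≠ k}) := by
        ext ω
        simp only [Set.mem_inter_iff, Set.mem_ofPred_eq, Set.mem_iUnion]
        constructor
        · rintro ⟨h1, h2⟩
          refine ⟨ω (m+1), ⟨h1, rfl⟩, fun i hi => ?_⟩
          have := h2 (1+i) (by omega)
          rwa [← add_assoc] at this
        · rintro ⟨j, ⟨h1, _⟩, h2⟩
          refine ⟨h1, fun i hi => ?_⟩
          rcases i with _ | i
          · rw [add_zero, hx ω h1]; exact h
          · have := h2 i (by omega)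
            rwa [add_assoc, add_comm 1 i] at this
      have hB' : ∀ j, DetBy (m+1) (B ∩ {ω | ω (m+1) = j}) := by
        intro j ω ω' hh hω
        exact ⟨hB ω ω' (fun i hi => hh i (by omega)) hω.1,
          by have := hω.2; simp only [Set.mem_ofPred_eq] at this ⊢; rw [← hh (m+1) le_rfl]; exact this⟩
      have hm : MeasurableSet {ω : ℕ → ℕ | ∀ i ≤ l, ω (m+1+i) ≠ k} := by
        have : {ω : ℕ → ℕ | ∀ i ≤ l, ω (m+1+i) ≠ k}
            = ⋂ i, ⋂ (_ : i ≤ l), {ω | ω (m+1+i) ≠ k} := by ext ω; simp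
        rw [this]
        exact MeasurableSet.iInter fun i => MeasurableSet.iInter fun _ => meas_ne _ _
      rw [e, measure_iUnion]
      · have : ∀ j, μ ((B ∩ {ω | ω (m+1) = j}) ∩ {ω | ∀ i ≤ l, ω (m+1+i) ≠ k})
            = ENNReal.ofReal (transX q p1 p2 x j) * ENNReal.ofReal (wr q p1 p2 k l j) * μ B := by
          intro j
          rw [ih (m+1) j _ (hB' j) (fun ω hω => hω.2), one_step hμ hB hx j]
          ring
        simp_rw [this]
        rw [ENNReal.tsum_mul_right, tsum_transX hq hp1 hp2 (wr_nonneg hq hp1 hp2 k l)]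
        rw [wr, if_neg h]
      · intro y z hyz
        rw [Function.onFun, Set.disjoint_left]
        rintro ω ⟨⟨_, h1⟩, _⟩ ⟨⟨_, h2⟩, _⟩
        exact hyz (h1.symm.trans h2)
      · intro j
        exact (hB' j).measurableSet.inter hm

lemma surv_forever [IsProbabilityMeasure μ]
    (hq : ∀ k, 2 ≤ k → 0 < q k) (hp1 : ∀ k, 2 ≤ k → 0 ≤ p1 k)
    (hp2 : ∀ k, 2 ≤ k → 0 < p2 k) (hsum : ∀ k, 2 ≤ k → q k + p1 k + p2 k = 1)
    {s : ℕ} (hμ : IsMarkovChain μ (transX q p1 p2) s)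
    (k m x : ℕ) (B : Set (ℕ → ℕ)) (hB : DetBy m B) (hx : ∀ ω ∈ B, ω m = x) :
      μ (B ∩ {ω | ∀ i, ω (m+i) ≠ k}) = ENNReal.ofReal (wlim q p1 p2 k x) * μ B := by
  have hm : ∀ l, MeasurableSet {ω : ℕ → ℕ | ∀ i ≤ l, ω (m+i) ≠ k} := by
    intro l
    have : {ω : ℕ → ℕ | ∀ i ≤ l, ω (m+i) ≠ k}
        = ⋂ i, ⋂ (_ : i ≤ l), {ω | ω (m+i) ≠ k} := by ext ω; simp
    rw [this]
    exact MeasurableSet.iInter fun i => MeasurableSet.iInter fun _ => meas_ne _ _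
  have e : B ∩ {ω | ∀ i, ω (m+i) ≠ k} = ⋂ l : ℕ, (B ∩ {ω | ∀ i ≤ l, ω (m+i) ≠ k}) := by
    ext ω
    simp only [Set.mem_inter_iff, Set.mem_ofPred_eq, Set.mem_iInter]
    constructor
    · rintro ⟨h1, h2⟩ l
      exact ⟨h1, fun i _ => h2 i⟩
    · intro h
      exact ⟨(h 0).1, fun i => (h i).2 i le_rfl⟩
  have t1 : Tendsto (fun l => μ (B ∩ {ω | ∀ i ≤ l, ω (m+i) ≠ k})) atTop
      (𝓝 (μ (⋂ l : ℕ, (B ∩ {ω | ∀ i ≤ l, ω (m+i) ≠ k})))) := by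
    apply tendsto_measure_iInter_atTop
    · exact fun l => (hB.measurableSet.inter (hm l)).nullMeasurableSet
    · intro l l' hll ω hω
      exact ⟨hω.1, fun i hi => hω.2 i (hi.trans hll)⟩
    · exact ⟨0, measure_ne_top _ _⟩
  rw [← e] at t1
  refine tendsto_nhds_unique t1 ?_
  simp_rw [surv hq hp1 hp2 hμ k _ m x B hB hx]
  exact ENNReal.Tendsto.mul_const
    (ENNReal.tendsto_ofReal (wr_tendsto hq hp1 hp2 hsum k x)) (Or.inr (measure_ne_top _ _))

/-- the event that `k` is a cutpoint -/
def cutSet (k : ℕ) : Set (ℕ → ℕ) := {ω | ∃! m, ω m = k}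

lemma cutSet_eq (k : ℕ) : cutSet k = ⋃ m : ℕ,
    ({ω : ℕ → ℕ | (∀ i < m, ω i ≠ k) ∧ ω m = k} ∩ {ω | ∀ i, ω (m+1+i) ≠ k}) := by
  ext ω
  simp only [cutSet, Set.mem_ofPred_eq, Set.mem_iUnion, Set.mem_inter_iff]
  constructor
  · rintro ⟨m, hm, hu⟩
    refine ⟨m, ⟨fun i hi h => ?_, hm⟩, fun i h => ?_⟩
    · have := hu i h; omega
    · have := hu _ h; omega
  · rintro ⟨m, ⟨h1, h2⟩, h3⟩
    refine ⟨m, h2, fun i hi => ?_⟩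
    rcases lt_trichotomy i m with h | h | h
    · exact absurd hi (h1 i h)
    · exact h
    · exact absurd hi (by have := h3 (i - (m+1)); rwa [show m+1+(i-(m+1)) = i by omega] at this)

lemma firstHit_detBy (k m : ℕ) :
    DetBy m {ω : ℕ → ℕ | (∀ i < m, ω i ≠ k) ∧ ω m = k} := by
  rintro ω ω' h ⟨h1, h2⟩
  refine ⟨fun i hi => ?_, ?_⟩
  · rw [← h i hi.le]; exact h1 i hi
  · rw [← h m le_rfl]; exact h2

lemma firstHit_disj (k : ℕ) : Pairwise (Function.onFun Disjoint
    (fun m => {ω : ℕ → ℕ | (∀ i < m, ω i ≠ k) ∧ ω m = k})) := by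
  intro y z hyz
  rw [Function.onFun, Set.disjoint_left]
  rintro ω ⟨h1, h2⟩ ⟨h3, h4⟩
  rcases lt_trichotomy y z with h | h | h
  · exact h3 y h h2
  · exact hyz h
  · exact h1 z h h4

lemma meas_forever (m k : ℕ) : MeasurableSet {ω : ℕ → ℕ | ∀ i, ω (m+i) ≠ k} := by
  have : {ω : ℕ → ℕ | ∀ i, ω (m+i) ≠ k} = ⋂ i, {ω | ω (m+i) ≠ k} := by ext ω; simp
  rw [this]
  exact MeasurableSet.iInter fun i => meas_ne _ _

lemma cutSet_meas (k : ℕ) : MeasurableSet (cutSet k) := by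
  rw [cutSet_eq]
  exact MeasurableSet.iUnion fun m => (firstHit_detBy k m).measurableSet.inter (meas_forever _ _)

lemma hit_one [IsProbabilityMeasure μ]
    (hq : ∀ k, 2 ≤ k → 0 < q k) (hp1 : ∀ k, 2 ≤ k → 0 ≤ p1 k)
    (hp2 : ∀ k, 2 ≤ k → 0 < p2 k) (hsum : ∀ k, 2 ≤ k → q k + p1 k + p2 k = 1)
    (hμ : IsMarkovChain μ (transX q p1 p2) 2) (k : ℕ) (hk : 2 ≤ k) :
    ∑' m : ℕ, μ {ω : ℕ → ℕ | (∀ i < m, ω i ≠ k) ∧ ω m = k} = 1 := by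
  rw [← measure_iUnion (firstHit_disj k) (fun m => (firstHit_detBy k m).measurableSet)]
  have e : (⋃ m : ℕ, {ω : ℕ → ℕ | (∀ i < m, ω i ≠ k) ∧ ω m = k})
      = {ω : ℕ → ℕ | ∀ i, ω (0+i) ≠ k}ᶜ := by
    ext ω
    simp only [Set.mem_iUnion, Set.mem_ofPred_eq, Set.mem_compl_iff, not_forall, not_not, zero_add]
    constructor
    · rintro ⟨m, _, h⟩; exact ⟨m, h⟩
    · intro h
      classical
      exact ⟨Nat.find h, fun i hi => Nat.find_min h hi, Nat.find_spec h⟩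
  rw [e, prob_compl_eq_one_iff (meas_forever 0 k)]
  have h0 := surv_forever hq hp1 hp2 hsum hμ k 0 2 {ω | ω 0 = 2}
    (by intro ω ω' h h'; simp only [Set.mem_ofPred_eq] at *; rw [← h 0 le_rfl]; exact h')
    (fun ω hω => hω)
  rw [wlim_low hq hp1 hp2 hsum k 2 hk, ENNReal.ofReal_zero, zero_mul] at h0
  have h1 : μ {ω : ℕ → ℕ | ω 0 = 2}ᶜ = 0 :=
    (prob_compl_eq_zero_iff (meas_coord 0 2)).2 hμ.1
  refine le_antisymm ?_ zero_le
  calc μ {ω : ℕ → ℕ | ∀ i, ω (0+i) ≠ k}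
      ≤ μ (({ω : ℕ → ℕ | ω 0 = 2} ∩ {ω : ℕ → ℕ | ∀ i, ω (0+i) ≠ k}) ∪ {ω : ℕ → ℕ | ω 0 = 2}ᶜ) := by
        apply measure_mono
        intro ω hω
        by_cases h : ω 0 = 2
        · exact Or.inl ⟨h, hω⟩
        · exact Or.inr h
    _ ≤ _ := measure_union_le _ _
    _ = 0 := by rw [h0, h1, add_zero]

lemma cut_prob [IsProbabilityMeasure μ]
    (hq : ∀ k, 2 ≤ k → 0 < q k) (hp1 : ∀ k, 2 ≤ k → 0 ≤ p1 k)
    (hp2 : ∀ k, 2 ≤ k → 0 < p2 k) (hsum : ∀ k, 2 ≤ k → q k + p1 k + p2 k = 1)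
    (hμ : IsMarkovChain μ (transX q p1 p2) 2) (k : ℕ) (hk : 2 ≤ k) :
    μ (cutSet k) = ENNReal.ofReal (q k * wlim q p1 p2 k (k+1)) := by
  rw [cutSet_eq, measure_iUnion]
  · have : ∀ m : ℕ, μ ({ω : ℕ → ℕ | (∀ i < m, ω i ≠ k) ∧ ω m = k} ∩ {ω | ∀ i, ω (m+1+i) ≠ k})
        = ENNReal.ofReal (q k * wlim q p1 p2 k (k+1)) *
          μ {ω : ℕ → ℕ | (∀ i < m, ω i ≠ k) ∧ ω m = k} := by
      intro m
      set B := {ω : ℕ → ℕ | (∀ i < m, ω i ≠ k) ∧ ω m = k} with hBdef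
      have hB : DetBy m B := firstHit_detBy k m
      have hx : ∀ ω ∈ B, ω m = k := fun ω hω => hω.2
      have hB' : ∀ j, DetBy (m+1) (B ∩ {ω | ω (m+1) = j}) := by
        intro j ω ω' hh hω
        exact ⟨hB ω ω' (fun i hi => hh i (by omega)) hω.1,
          by have := hω.2; simp only [Set.mem_ofPred_eq] at this ⊢; rw [← hh (m+1) le_rfl]; exact this⟩
      have e : B ∩ {ω | ∀ i, ω (m+1+i) ≠ k}
          = ⋃ j, ((B ∩ {ω | ω (m+1) = j}) ∩ {ω | ∀ i, ω (m+1+i) ≠ k}) := by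
        ext ω
        simp
      rw [e, measure_iUnion]
      · have : ∀ j, μ ((B ∩ {ω | ω (m+1) = j}) ∩ {ω | ∀ i, ω (m+1+i) ≠ k})
            = ENNReal.ofReal (transX q p1 p2 k j) * ENNReal.ofReal (wlim q p1 p2 k j) * μ B := by
          intro j
          rw [surv_forever hq hp1 hp2 hsum hμ k (m+1) j _ (hB' j) (fun ω hω => hω.2),
            one_step hμ hB hx j]
          ring
        simp_rw [this]
        rw [ENNReal.tsum_mul_right, tsum_transX hq hp1 hp2 (wlim_nonneg hq hp1 hp2 hsum k)]
        have n0 : k ≠ 0 := by omega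
        have n1 : k ≠ 1 := by omega
        simp only [Pop, if_neg n0, if_neg n1]
        rw [wlim_low hq hp1 hp2 hsum k (k-1) (by omega),
          wlim_low hq hp1 hp2 hsum k (k-2) (by omega)]
        simp
      · intro y z hyz
        rw [Function.onFun, Set.disjoint_left]
        rintro ω ⟨⟨_, h1⟩, _⟩ ⟨⟨_, h2⟩, _⟩
        exact hyz (h1.symm.trans h2)
      · intro j
        exact (hB' j).measurableSet.inter (meas_forever _ _)
    simp_rw [this]
    rw [ENNReal.tsum_mul_left, hit_one hq hp1 hp2 hsum hμ k hk, mul_one]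
  · intro y z hyz
    exact (firstHit_disj k hyz).mono Set.inter_subset_left Set.inter_subset_left
  · exact fun m => (firstHit_detBy k m).measurableSet.inter (meas_forever _ _)

end prob

section det

/-- `(log log n)^β` -/
def ell (β : ℝ) (n : ℕ) : ℝ := Real.log (Real.log (n : ℝ)) ^ β

lemma tendsto_lognat : Tendsto (fun n : ℕ => Real.log (n : ℝ)) atTop atTop :=
  Real.tendsto_log_atTop.comp tendsto_natCast_atTop_atTop

lemma tendsto_loglognat : Tendsto (fun n : ℕ => Real.log (Real.log (n : ℝ))) atTop atTop :=
  Real.tendsto_log_atTop.comp tendsto_lognat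

lemma log_succ_sub_le (n : ℕ) (hn : 1 ≤ n) :
    Real.log ((n + 1 : ℕ) : ℝ) - Real.log (n : ℝ) ≤ 1 / (n : ℝ) := by
  have h : (0 : ℝ) < n := by exact_mod_cast hn
  rw [← Real.log_div (by positivity) h.ne']
  refine (Real.log_le_sub_one_of_pos (by positivity)).trans (le_of_eq ?_)
  push_cast
  field_simp
  ring

lemma le_log_succ_sub (n : ℕ) (hn : 1 ≤ n) :
    1 / ((n : ℝ) + 1) ≤ Real.log ((n + 1 : ℕ) : ℝ) - Real.log (n : ℝ) := by
  have h : (0 : ℝ) < n := by exact_mod_cast hn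
  have h1 : Real.log (n : ℝ) - Real.log ((n + 1 : ℕ) : ℝ) ≤ - (1 / ((n : ℝ) + 1)) := by
    rw [← Real.log_div h.ne' (by positivity)]
    refine (Real.log_le_sub_one_of_pos (by positivity)).trans (le_of_eq ?_)
    push_cast
    field_simp
    ring
  linarith

/-- regularity facts about `ell` at `n` -/
structure EllFacts (β : ℝ) (n : ℕ) : Prop where
  npos : 4 ≤ n
  one_le : 1 ≤ ell β n
  mono : ell β n ≤ ell β (n+1)
  incr : (n : ℝ) * Real.log n * Real.log (Real.log n) * (ell β (n+1) - ell β n) ≤ ell β n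
  le_x : ell β n ≤ Real.log (Real.log n)
  four : 4 ≤ Real.log (Real.log n)
  xlog : 2 * Real.log (Real.log n) ≤ Real.log n

lemma ell_facts {β : ℝ} (hβ0 : 0 ≤ β) (hβ1 : β < 1) : ∀ᶠ n : ℕ in atTop, EllFacts β n := by
  have hlo : ∀ᶠ y : ℝ in atTop, 2 * Real.log y ≤ y := by
    have := Real.isLittleO_log_id_atTop.bound (show (0:ℝ) < 1/2 by norm_num)
    filter_upwards [this, eventually_ge_atTop (1:ℝ)] with y hy hy1
    rw [Real.norm_of_nonneg (Real.log_nonneg hy1)] at hy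
    simp only [id, Real.norm_eq_abs, abs_of_nonneg (zero_le_one.trans hy1)] at hy
    linarith
  filter_upwards [eventually_ge_atTop 4, tendsto_loglognat.eventually_ge_atTop 4,
    tendsto_lognat.eventually_ge_atTop 1, tendsto_lognat.eventually hlo] with n h4 hx hl hxl
  have hn0 : (0:ℝ) < n := by positivity
  set L := Real.log (n:ℝ) with hL
  set x := Real.log L with hxdef
  have hLpos : 0 < L := by linarith
  have hL' : L ≤ Real.log ((n+1 : ℕ) : ℝ) := Real.log_le_log hn0 (by push_cast; linarith)
  set L' := Real.log ((n+1 : ℕ) : ℝ) with hL'def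
  set x' := Real.log L' with hx'def
  have hxx' : x ≤ x' := Real.log_le_log hLpos hL'
  have hLL := log_succ_sub_le n (by omega)
  have hxx : x' - x ≤ 1 / (n * L) := by
    have hL'pos : 0 < L' := by linarith
    rw [hx'def, hxdef, ← Real.log_div (by linarith) hLpos.ne']
    refine (Real.log_le_sub_one_of_pos (by positivity)).trans ?_
    rw [show L'/L - 1 = (L' - L)/L by field_simp, ← div_div]
    gcongr
  have hmono : ell β n ≤ ell β (n+1) := by
    unfold ell
    exact Real.rpow_le_rpow (by linarith) hxx' hβ0
  have hell0 : 1 ≤ ell β n := Real.one_le_rpow (by linarith) hβ0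
  refine ⟨h4, hell0, hmono, ?_, ?_, hx, hxl⟩
  · have hx0 : 0 < x := by linarith
    have h1 : ell β (n+1) ≤ ell β n * (x'/x) := by
      have e : x' = x * (x'/x) := by field_simp
      have hr : 1 ≤ x'/x := (one_le_div hx0).2 hxx'
      have : ell β (n+1) = x ^ β * (x'/x) ^ β := by
        rw [← Real.mul_rpow hx0.le (by linarith), ← e]; rfl
      rw [this]
      have : (x'/x)^β ≤ x'/x := by
        calc (x'/x)^β ≤ (x'/x)^(1:ℝ) := Real.rpow_le_rpow_of_exponent_le hr hβ1.le
          _ = _ := Real.rpow_one _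
      exact mul_le_mul_of_nonneg_left this (by positivity)
    have h2 : x * (ell β (n+1) - ell β n) ≤ ell β n * (x' - x) := by
      have : ell β n * (x'/x) * x = ell β n * x' := by field_simp
      nlinarith
    have h3 : n * L * (x' - x) ≤ 1 := by
      have : 0 < n * L := by positivity
      rw [le_div_iff₀ this] at hxx; linarith
    calc n * L * x * (ell β (n+1) - ell β n) = n * L * (x * (ell β (n+1) - ell β n)) := by ring
      _ ≤ n * L * (ell β n * (x' - x)) := by gcongr
      _ = ell β n * (n * L * (x' - x)) := by ring
      _ ≤ ell β n * 1 := by gcongr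
      _ = _ := mul_one _
  · calc ell β n ≤ x ^ (1:ℝ) := Real.rpow_le_rpow_of_exponent_le (by linarith) hβ1.le
      _ = x := Real.rpow_one _

lemma EllFacts.nincr {β : ℝ} {n : ℕ} (h : EllFacts β n) :
    (n : ℝ) * (ell β (n+1) - ell β n) ≤ 1 / 8 := by
  obtain ⟨h4, h1, hm, hi, hx, hx4, hxl⟩ := h
  set L := Real.log (n:ℝ)
  set x := Real.log L
  have hL8 : 8 ≤ L := by linarith
  have hn : (0:ℝ) ≤ n := by positivity
  have hd : 0 ≤ (n:ℝ) * (ell β (n+1) - ell β n) := mul_nonneg hn (by linarith)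
  have h2 : x * (L * ((n : ℝ) * (ell β (n+1) - ell β n))) ≤ x * 1 := by
    calc _ = (n : ℝ) * L * x * (ell β (n+1) - ell β n) := by ring
      _ ≤ ell β n := hi
      _ ≤ x * 1 := by linarith
  have h3 := le_of_mul_le_mul_left h2 (by linarith)
  nlinarith

lemma small_ell {β : ℝ} (hβ0 : 0 ≤ β) (hβ1 : β < 1) (K : ℝ) (hK : 0 < K) :
    ∀ᶠ n : ℕ in atTop, K * ell β n ≤ (1/4) * n := by
  have := Real.isLittleO_log_id_atTop.bound (show (0:ℝ) < 1/(4*K) by positivity)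
  have := tendsto_natCast_atTop_atTop.eventually this
  filter_upwards [this, ell_facts hβ0 hβ1] with n hn hf
  have hl : 0 ≤ Real.log (n:ℝ) := by linarith [hf.four, hf.xlog]
  simp only [id, Real.norm_eq_abs, abs_of_nonneg hl, Nat.abs_cast] at hn
  have : ell β n ≤ 1/(4*K) * n := by linarith [hf.le_x, hf.xlog, hf.four]
  calc K * ell β n ≤ K * (1/(4*K) * n) := by gcongr
    _ = _ := by field_simp

/-- perturbed ratio -/
def sig (β s : ℝ) (n : ℕ) : ℝ :=
  1 - 1 / (n:ℝ) - 1 / ((n:ℝ) * ell β n) + s / (n:ℝ)^2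

lemma bracket {β s : ℝ} {n : ℕ} (h : EllFacts β n) (h1 : 1 ≤ ell β (n+1))
    (hs : |s| * ell β (n+1) ≤ (1/4) * ((n+1:ℕ):ℝ)) :
    1/2 ≤ n * ell β n - ((n+1:ℕ):ℝ) * ell β (n+1) * sig β s (n+1) ∧
    n * ell β n - ((n+1:ℕ):ℝ) * ell β (n+1) * sig β s (n+1) ≤ 2 := by
  have hN : (0:ℝ) < ((n+1:ℕ):ℝ) := by positivity
  have hl : 0 < ell β (n+1) := by linarith
  have e : n * ell β n - ((n+1:ℕ):ℝ) * ell β (n+1) * sig β s (n+1)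
      = 1 - n * (ell β (n+1) - ell β n) - s * ell β (n+1) / ((n+1:ℕ):ℝ) := by
    unfold sig
    push_cast at hN ⊢
    field_simp
    ring
  rw [e]
  have h2 : |s * ell β (n+1) / ((n+1:ℕ):ℝ)| ≤ 1/4 := by
    rw [abs_div, abs_mul, abs_of_pos hl, abs_of_pos hN, div_le_iff₀ hN]; exact hs
  have h3 := abs_le.1 h2
  have h4 := h.nincr
  have h5 : 0 ≤ (n:ℝ) * (ell β (n+1) - ell β n) :=
    mul_nonneg (by positivity) (by linarith [h.mono])
  constructor <;> linarith [h3.1, h3.2]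

lemma sum_bounds {β s : ℝ} (k : ℕ) (hf : ∀ n, k ≤ n → EllFacts β n)
    (hs : ∀ n, k ≤ n → |s| * ell β n ≤ (1/4) * n)
    (hpos : ∀ n, k ≤ n → 0 < sig β s n) :
    (∀ N, ∑ i ∈ Finset.range N, ∏ j ∈ Finset.range i, sig β s (k+j+1) ≤ 2 * (k * ell β k)) ∧
    (∃ N, (k * ell β k) / 4 ≤ ∑ i ∈ Finset.range N, ∏ j ∈ Finset.range i, sig β s (k+j+1)) := by
  set P : ℕ → ℝ := fun i => ∏ j ∈ Finset.range i, sig β s (k+j+1) with hP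
  have hPpos : ∀ i, 0 < P i := fun i => Finset.prod_pos (fun j _ => hpos _ (by omega))
  have hPs : ∀ i, P (i+1) = P i * sig β s (k+i+1) := fun i => Finset.prod_range_succ _ _
  set g : ℕ → ℝ := fun i => ((k+i:ℕ):ℝ) * ell β (k+i) * P i with hg
  have hgpos : ∀ i, 0 < g i := by
    intro i
    have h1 := (hf (k+i) (by omega)).one_le
    have h4 := (hf (k+i) (by omega)).npos
    have : (0:ℝ) < ((k+i:ℕ):ℝ) := by exact_mod_cast (by omega)
    have := hPpos i
    simp only [hg]
    have : 0 < ell β (k+i) := by linarith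
    positivity
  have hg0 : g 0 = k * ell β k := by simp [hg, hP]
  have hstep : ∀ i, P i / 2 ≤ g i - g (i+1) ∧ g i - g (i+1) ≤ 2 * P i := by
    intro i
    have hb := bracket (s := s) (hf (k+i) (by omega)) (hf (k+i+1) (by omega)).one_le
      (hs (k+i+1) (by omega))
    have e : g i - g (i+1) = P i * (((k+i:ℕ):ℝ) * ell β (k+i)
        - ((k+i+1:ℕ):ℝ) * ell β (k+i+1) * sig β s (k+i+1)) := by
      simp only [hg, hPs]
      rw [← add_assoc]; ring
    rw [e]
    have := hPpos i
    constructor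
    · nlinarith [hb.1]
    · nlinarith [hb.2]
  have hup : ∀ N, ∑ i ∈ Finset.range N, P i ≤ 2 * (g 0 - g N) := by
    intro N
    induction N with
    | zero => simp
    | succ N ih => rw [Finset.sum_range_succ]; linarith [(hstep N).1]
  have hlo : ∀ N, (g 0 - g N) / 2 ≤ ∑ i ∈ Finset.range N, P i := by
    intro N
    induction N with
    | zero => simp
    | succ N ih => rw [Finset.sum_range_succ]; linarith [(hstep N).2]
  have hglog : ∀ i, g i * Real.log ((k+i:ℕ):ℝ) ≤ g 0 * Real.log (k:ℝ) := by
    intro i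
    induction i with
    | zero => simp
    | succ i ih =>
      refine le_trans ?_ ih
      have F := hf (k+i) (by omega)
      have hn : (0:ℝ) < ((k+i:ℕ):ℝ) := by
        have := F.npos
        exact_mod_cast (by omega)
      have h1 := (hstep i).1
      have hl0 : 0 < ell β (k+i) := by linarith [F.one_le]
      have hPg : P i = g i / (((k+i:ℕ):ℝ) * ell β (k+i)) := by
        simp only [hg]; field_simp
      have h2 := log_succ_sub_le (k+i) (by have := F.npos; omega)
      have h3 : 2 * ell β (k+i) ≤ Real.log ((k+i:ℕ):ℝ) := by linarith [F.le_x, F.xlog]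
      set L := Real.log ((k+i:ℕ):ℝ)
      rw [← add_assoc]
      set L' := Real.log ((k+i+1:ℕ):ℝ)
      have hP' := hPpos i
      have hgp := hgpos (i+1)
      have hgi := hgpos i
      -- g(i+1) L' ≤ g(i+1) (L + 1/n) ≤ g(i+1) L + g i / n
      have a1 : g (i+1) * L' ≤ g (i+1) * L + g (i+1) * (1 / ((k+i:ℕ):ℝ)) := by
        rw [← mul_add]; exact mul_le_mul_of_nonneg_left (by linarith) hgp.le
      have a2 : g (i+1) * (1 / ((k+i:ℕ):ℝ)) ≤ g i * (1 / ((k+i:ℕ):ℝ)) :=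
        mul_le_mul_of_nonneg_right (by linarith) (by positivity)
      have a3 : g i * (1 / ((k+i:ℕ):ℝ)) = P i * ell β (k+i) := by
        rw [hPg]; field_simp
      have hL : 0 ≤ L := by linarith
      have a4 : P i / 2 * L ≤ (g i - g (i+1)) * L := mul_le_mul_of_nonneg_right h1 hL
      nlinarith
  refine ⟨fun N => ?_, ?_⟩
  · have := hup N; have := hgpos N; rw [← hg0]; linarith
  · have ht : Tendsto (fun i : ℕ => Real.log ((k+i:ℕ):ℝ)) atTop atTop := by
      have : Tendsto (fun i : ℕ => k + i) atTop atTop := tendsto_atTop_mono (fun i => Nat.le_add_left i k) tendsto_id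
      exact tendsto_lognat.comp this
    obtain ⟨N, hN⟩ := ((ht.eventually_ge_atTop (2 * Real.log (k:ℝ))).and (ht.eventually_gt_atTop 0)).exists
    refine ⟨N, ?_⟩
    have h1 := hglog N
    have h2 := hlo N
    have h3 : g N ≤ g 0 / 2 := by
      have := hgpos 0
      have hlp := hN.2
      by_contra hc
      push Not at hc
      nlinarith [mul_lt_mul_of_pos_right hc hlp, hN.1]
    rw [← hg0]; linarith

end det

section det2
variable {q p1 p2 : ℕ → ℝ}

lemma rho_facts (hq : ∀ k, 2 ≤ k → 0 < q k) (hp1 : ∀ k, 2 ≤ k → 0 ≤ p1 k)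
    (hp2 : ∀ k, 2 ≤ k → 0 < p2 k) (k : ℕ) (hk : 2 ≤ k) :
    0 < rho q p1 p2 k ∧ rho q p1 p2 k ^ 2
      = (p1 k + p2 k) / q k * rho q p1 p2 k + p2 k / q k := by
  have h1 := hq k hk; have h2 := hp1 k hk; have h3 := hp2 k hk
  unfold rho
  set A := (p1 k + p2 k) / q k with hA
  set B := p2 k / q k with hB
  have hA0 : 0 < A := by rw [hA]; positivity
  have hB0 : 0 < B := by rw [hB]; positivity
  have hs := Real.sq_sqrt (show 0 ≤ A^2 + 4*B by positivity)
  constructor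
  · positivity
  · nlinarith

lemma rho_est {β : ℝ} (hβ0 : 0 ≤ β) (hβ1 : β < 1)
    (hrho : (fun k => rho q p1 p2 k - (1 - 3 * rseq β k))
      =O[atTop] fun k => rseq β k ^ 2) :
    ∃ C : ℝ, 0 < C ∧ ∀ᶠ n : ℕ in atTop,
      |rho q p1 p2 n - (1 - 1/(n:ℝ) - 1/((n:ℝ) * ell β n))| ≤ C / (n:ℝ)^2 := by
  obtain ⟨C, hC, hb⟩ := hrho.exists_pos
  refine ⟨C, hC, ?_⟩
  filter_upwards [hb.bound, ell_facts hβ0 hβ1] with n hn hf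
  have h4 := hf.npos
  have hn0 : (0:ℝ) < n := by positivity
  have hl := hf.one_le
  have e : 3 * rseq β n = 1/(n:ℝ) + 1/((n:ℝ) * ell β n) := by
    simp only [rseq, if_pos h4, ell]; ring
  have e' : rho q p1 p2 n - (1 - 3 * rseq β n)
      = rho q p1 p2 n - (1 - 1/(n:ℝ) - 1/((n:ℝ) * ell β n)) := by rw [e]; ring
  rw [e', Real.norm_eq_abs, Real.norm_eq_abs, abs_of_nonneg (sq_nonneg (rseq β n))] at hn
  refine hn.trans ?_
  have h1 : 1/((n:ℝ) * ell β n) ≤ 1/(n:ℝ) := by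
    apply one_div_le_one_div_of_le hn0; nlinarith
  have h0 : 0 ≤ 1/((n:ℝ) * ell β n) := by positivity
  have h0' : 0 < 1/(n:ℝ) := by positivity
  have h2 : rseq β n ≤ 1/(n:ℝ) := by linarith
  have h3 : 0 ≤ rseq β n := by linarith
  calc C * rseq β n ^ 2 ≤ C * (1/(n:ℝ))^2 := by gcongr
    _ = _ := by field_simp

/-- everything needed at site `n` for the comparison -/
structure SigFacts (q p1 p2 : ℕ → ℝ) (β K : ℝ) (n : ℕ) : Prop where
  pos : 0 < sig β (-K) n
  le_one : sig β (-K) n ≤ 1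
  lo : sig β (-K) n ≤ rho q p1 p2 n
  hi : rho q p1 p2 n ≤ sig β K n
  lo' : sig β (-K) n ≤ rho q p1 p2 (n+1)
  hi' : rho q p1 p2 (n+1) ≤ sig β K n

lemma sig_facts {β : ℝ} (hβ0 : 0 ≤ β) (hβ1 : β < 1)
    (hrho : (fun k => rho q p1 p2 k - (1 - 3 * rseq β k))
      =O[atTop] fun k => rseq β k ^ 2) :
    ∃ K : ℝ, 0 < K ∧ ∀ᶠ n : ℕ in atTop, SigFacts q p1 p2 β K n := by
  obtain ⟨C, hC, hb⟩ := rho_est hβ0 hβ1 hrho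
  refine ⟨C + 3, by positivity, ?_⟩
  filter_upwards [hb, (tendsto_add_atTop_nat 1).eventually hb, ell_facts hβ0 hβ1,
    (tendsto_add_atTop_nat 1).eventually (ell_facts hβ0 hβ1),
    tendsto_natCast_atTop_atTop.eventually_ge_atTop (C + 8 : ℝ)] with n h1 h2 hf hf' hbig
  have h4 := hf.npos
  have hn0 : (0:ℝ) < n := by positivity
  have hl := hf.one_le
  have hl' := hf'.one_le
  have hinc := hf.nincr
  have hmono := hf.mono
  have a1 := abs_le.1 h1
  have a2 := abs_le.1 h2
  push_cast at a2
  set l := ell β n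
  set l' := ell β (n+1)
  have hsq : 0 < (n:ℝ)^2 := by positivity
  -- differences
  have d1 : 1/(n:ℝ) - 1/((n:ℝ)+1) ≤ 1/(n:ℝ)^2 := by
    rw [div_sub_div _ _ hn0.ne' (by positivity), div_le_div_iff₀ (by positivity) hsq]
    nlinarith
  have d1' : 1/((n:ℝ)+1) ≤ 1/(n:ℝ) := one_div_le_one_div_of_le hn0 (by linarith)
  have d2 : 1/((n:ℝ)*l) - 1/(((n:ℝ)+1)*l') ≤ 2/(n:ℝ)^2 := by
    rw [div_sub_div _ _ (by positivity) (by positivity), div_le_div_iff₀ (by positivity) hsq]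
    have e1 : 1 * (((n:ℝ)+1)*l') - (n:ℝ)*l*1 ≤ 2 * l' := by nlinarith
    have e2 : (n:ℝ)^2 ≤ (n:ℝ) * ((n:ℝ)+1) := by nlinarith
    have e3 : (n:ℝ) * ((n:ℝ)+1) * l' ≤ (n:ℝ)*l*(((n:ℝ)+1)*l') := by
      have : 0 ≤ (n:ℝ) * ((n:ℝ)+1) * l' := by positivity
      nlinarith
    calc (1 * (((n:ℝ)+1)*l') - (n:ℝ)*l*1) * (n:ℝ)^2 ≤ 2 * l' * (n:ℝ)^2 := by gcongr
      _ ≤ 2 * l' * ((n:ℝ) * ((n:ℝ)+1)) := by gcongr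
      _ ≤ _ := by linarith
  have d2' : 1/(((n:ℝ)+1)*l') ≤ 1/((n:ℝ)*l) := by
    apply one_div_le_one_div_of_le (by positivity)
    gcongr; linarith
  have d3 : C/((n:ℝ)+1)^2 ≤ C/(n:ℝ)^2 := by gcongr; linarith
  have d4 : 1/((n:ℝ)*l) ≤ 1/(n:ℝ) := by
    apply one_div_le_one_div_of_le hn0; nlinarith
  have d5 : 0 < 1/((n:ℝ)*l) := by positivity
  have d6 : 0 < 1/(n:ℝ) := by positivity
  have e1 : (C+3)/(n:ℝ)^2 = C/(n:ℝ)^2 + 1/(n:ℝ)^2 + 2/(n:ℝ)^2 := by ring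
  have e2 : -(C+3)/(n:ℝ)^2 = -(C/(n:ℝ)^2 + 1/(n:ℝ)^2 + 2/(n:ℝ)^2) := by ring
  have z1 : 0 < 1/(n:ℝ)^2 := by positivity
  have z2 : 0 < 2/(n:ℝ)^2 := by positivity
  have z3 : 0 < C/(n:ℝ)^2 := by positivity
  refine ⟨?_, ?_, ?_, ?_, ?_, ?_⟩
  · unfold sig
    have : (C+3)/(n:ℝ)^2 ≤ 1/(n:ℝ) := by
      rw [div_le_div_iff₀ hsq hn0]; nlinarith
    have t : 1/(n:ℝ) ≤ 1/8 := one_div_le_one_div_of_le (by norm_num) (by linarith)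
    have e3 : -(C+3)/(n:ℝ)^2 = -((C+3)/(n:ℝ)^2) := by ring
    rw [e3]; linarith
  · unfold sig; rw [e2]; linarith
  · unfold sig; rw [e2]; linarith [a1.1]
  · unfold sig; rw [e1]; linarith [a1.2]
  · unfold sig; rw [e2]; linarith [a2.1]
  · unfold sig; rw [e1]; linarith [a2.2]

lemma alg_up {A B P s s' x y : ℝ} (hA : 0 ≤ A) (hB : 0 ≤ B) (hP : 0 ≤ P)
    (h : A * s + B ≤ s * s') (hx : x ≤ P * s) (hy : y ≤ P) : A * x + B * y ≤ P * s * s' := by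
  have h1 := mul_le_mul_of_nonneg_left hx hA
  have h2 := mul_le_mul_of_nonneg_left hy hB
  have h3 := mul_le_mul_of_nonneg_left h hP
  linarith

lemma alg_lo {A B P s s' x y c : ℝ} (hA : 0 ≤ A) (hB : 0 ≤ B) (hP : 0 ≤ P) (hc : 0 ≤ c)
    (h : s * s' ≤ A * s + B) (hx : c * (P * s) ≤ x) (hy : c * P ≤ y) :
    c * (P * s * s') ≤ A * x + B * y := by
  have h1 := mul_le_mul_of_nonneg_left hx hA
  have h2 := mul_le_mul_of_nonneg_left hy hB
  have h3 := mul_le_mul_of_nonneg_left h (mul_nonneg hc hP)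
  linarith

lemma dseq_le (hq : ∀ k, 2 ≤ k → 0 < q k) (hp1 : ∀ k, 2 ≤ k → 0 ≤ p1 k)
    (hp2 : ∀ k, 2 ≤ k → 0 < p2 k) {β K : ℝ} (k : ℕ) (hk : 2 ≤ k)
    (hs : ∀ n, k ≤ n → SigFacts q p1 p2 β K n) (i : ℕ) :
    dseq q p1 p2 k i ≤ ∏ j ∈ Finset.range i, sig β K (k+j+1) := by
  have hpos : ∀ n, k ≤ n → 0 < sig β K n := fun n hn =>
    (rho_facts hq hp1 hp2 n (by omega)).1.trans_le (hs n hn).hi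
  induction i using Nat.strong_induction_on with
  | _ i ih =>
    rcases i with _ | _ | i
    · simp [dseq]
    · obtain ⟨r0, r1⟩ := rho_facts hq hp1 hp2 (k+1) (by omega)
      have h1 := (hs (k+1) (by omega)).hi
      have := hq (k+1) (by omega); have := hp2 (k+1) (by omega)
      have hb : 0 < p2 (k+1) / q (k+1) := by positivity
      simp only [dseq, zero_add, Finset.prod_range_one, add_zero]
      nlinarith
    · have i1 := ih (i+1) (by omega)
      have i2 := ih i (by omega)
      rw [Finset.prod_range_succ] at i1
      rw [Finset.prod_range_succ, Finset.prod_range_succ]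
      set P := ∏ j ∈ Finset.range i, sig β K (k+j+1)
      have hP : 0 < P := Finset.prod_pos (fun j _ => hpos _ (by omega))
      simp only [dseq]
      obtain ⟨r0, r1⟩ := rho_facts hq hp1 hp2 (k+i+2) (by omega)
      have := hq (k+i+2) (by omega); have := hp2 (k+i+2) (by omega)
      have := hp1 (k+i+2) (by omega)
      have hb : 0 < p2 (k+i+2) / q (k+i+2) := by positivity
      have ha : 0 ≤ (p1 (k+i+2) + p2 (k+i+2)) / q (k+i+2) := by positivity
      have s1 := (hs (k+i+1) (by omega)).hi'
      have s2 := (hs (k+i+2) (by omega)).hi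
      rw [show k + (i+1) + 1 = k+i+2 by ring]
      set A := (p1 (k+i+2) + p2 (k+i+2)) / q (k+i+2)
      set B := p2 (k+i+2) / q (k+i+2)
      set r := rho q p1 p2 (k+i+2)
      set s := sig β K (k+i+1)
      set s' := sig β K (k+i+2)
      have c1 : A * s + B ≤ s * s' := by
        have hs0 : 0 < s := r0.trans_le s1
        have : r * (A * s + B) ≤ r * (s * r) := by
          have : B * r ≤ B * s := by gcongr
          nlinarith
        have := le_of_mul_le_mul_left this r0
        have : s * r ≤ s * s' := by gcongr
        linarith
      exact alg_up ha hb.le hP.le c1 i1 i2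

lemma le_dseq (hq : ∀ k, 2 ≤ k → 0 < q k) (hp1 : ∀ k, 2 ≤ k → 0 ≤ p1 k)
    (hp2 : ∀ k, 2 ≤ k → 0 < p2 k) {β K : ℝ} (k : ℕ) (hk : 2 ≤ k)
    (hs : ∀ n, k ≤ n → SigFacts q p1 p2 β K n) (c : ℝ) (hc0 : 0 < c) (hc1 : c ≤ 1)
    (hca : c ≤ (p1 (k+1) + p2 (k+1)) / q (k+1)) (i : ℕ) :
    c * ∏ j ∈ Finset.range i, sig β (-K) (k+j+1) ≤ dseq q p1 p2 k i := by
  have hpos : ∀ n, k ≤ n → 0 < sig β (-K) n := fun n hn => (hs n hn).pos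
  induction i using Nat.strong_induction_on with
  | _ i ih =>
    rcases i with _ | _ | i
    · simpa [dseq] using hc1
    · have h1 := (hs (k+1) (by omega)).le_one
      simp only [dseq, zero_add, Finset.prod_range_one, add_zero]
      nlinarith
    · have i1 := ih (i+1) (by omega)
      have i2 := ih i (by omega)
      rw [Finset.prod_range_succ] at i1
      rw [Finset.prod_range_succ, Finset.prod_range_succ]
      set P := ∏ j ∈ Finset.range i, sig β (-K) (k+j+1)
      have hP : 0 < P := Finset.prod_pos (fun j _ => hpos _ (by omega))
      simp only [dseq]
      obtain ⟨r0, r1⟩ := rho_facts hq hp1 hp2 (k+i+2) (by omega)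
      have := hq (k+i+2) (by omega); have := hp2 (k+i+2) (by omega)
      have := hp1 (k+i+2) (by omega)
      have hb : 0 < p2 (k+i+2) / q (k+i+2) := by positivity
      have ha : 0 ≤ (p1 (k+i+2) + p2 (k+i+2)) / q (k+i+2) := by positivity
      have s1 := (hs (k+i+1) (by omega)).lo'
      have s2 := (hs (k+i+2) (by omega)).lo
      have s3 := (hs (k+i+1) (by omega)).pos
      rw [show k + (i+1) + 1 = k+i+2 by ring]
      set A := (p1 (k+i+2) + p2 (k+i+2)) / q (k+i+2)
      set B := p2 (k+i+2) / q (k+i+2)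
      set r := rho q p1 p2 (k+i+2)
      set s := sig β (-K) (k+i+1)
      set s' := sig β (-K) (k+i+2)
      have c1 : s * s' ≤ A * s + B := by
        have : r * (s * r) ≤ r * (A * s + B) := by
          have : B * s ≤ B * r := by gcongr
          nlinarith
        have := le_of_mul_le_mul_left this r0
        have : s * s' ≤ s * r := by gcongr
        linarith
      exact alg_lo ha hb.le hP.le hc0.le c1 i1 i2

lemma cut_bounds (hq : ∀ k, 2 ≤ k → 0 < q k) (hp1 : ∀ k, 2 ≤ k → 0 ≤ p1 k)
    (hp2 : ∀ k, 2 ≤ k → 0 < p2 k) (hsum : ∀ k, 2 ≤ k → q k + p1 k + p2 k = 1)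
    (a : ℝ) (ha : 0 < a)
    (hCa : Tendsto (fun k => (p1 k + p2 k) / q k) atTop (𝓝 a))
    (β : ℝ) (hβ0 : 0 ≤ β) (hβ1 : β < 1)
    (hrho : (fun k => rho q p1 p2 k - (1 - 3 * rseq β k))
      =O[atTop] fun k => rseq β k ^ 2) :
    ∃ c C : ℝ, 0 < c ∧ 0 < C ∧ ∀ᶠ k : ℕ in atTop,
      c * (1 / (k * ell β k)) ≤ q k * wlim q p1 p2 k (k+1) ∧
      q k * wlim q p1 p2 k (k+1) ≤ C * (1 / (k * ell β k)) := by
  obtain ⟨K, hK, hsig⟩ := sig_facts hβ0 hβ1 hrho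
  set c0 := min 1 (a/2) with hc0
  have hc0pos : 0 < c0 := by rw [hc0]; positivity
  have hA1 : ∀ᶠ k : ℕ in atTop, a/2 < (p1 k + p2 k) / q k :=
    hCa.eventually (lt_mem_nhds (by linarith))
  have hA2 : ∀ᶠ k : ℕ in atTop, (p1 k + p2 k) / q k < a + 1 :=
    hCa.eventually (gt_mem_nhds (by linarith))
  obtain ⟨N, hN⟩ := eventually_atTop.1 (hsig.and ((ell_facts hβ0 hβ1).and
    ((small_ell hβ0 hβ1 K hK).and (hA1.and (hA2.and (eventually_ge_atTop 2))))))
  refine ⟨1/(a+2) * (1/2), 4 / c0, by positivity, by positivity, ?_⟩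
  filter_upwards [eventually_ge_atTop N] with k hk
  have hk2 : 2 ≤ k := (hN k hk).2.2.2.2.2
  have hs : ∀ n, k ≤ n → SigFacts q p1 p2 β K n := fun n hn => (hN n (hk.trans hn)).1
  have hf : ∀ n, k ≤ n → EllFacts β n := fun n hn => (hN n (hk.trans hn)).2.1
  have hsm : ∀ n, k ≤ n → K * ell β n ≤ (1/4) * n := fun n hn => (hN n (hk.trans hn)).2.2.1
  have hU := (sum_bounds (s := K) k hf (fun n hn => by rw [abs_of_pos hK]; exact hsm n hn)
    (fun n hn => (rho_facts hq hp1 hp2 n (by omega)).1.trans_le (hs n hn).hi)).1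
  obtain ⟨M, hM⟩ := (sum_bounds (s := -K) k hf
    (fun n hn => by rw [abs_neg, abs_of_pos hK]; exact hsm n hn)
    (fun n hn => (hs n hn).pos)).2
  have hkl : 0 < (k:ℝ) * ell β k := by
    have := (hf k le_rfl).one_le
    have : (0:ℝ) < k := by positivity
    positivity
  set T := (k:ℝ) * ell β k
  have hlow : 1 / (2 * T) ≤ wlim q p1 p2 k (k+1) :=
    wlim_lower hq hp1 hp2 hsum k hk2 (2*T) (by positivity) (fun i =>
      (Finset.sum_le_sum (fun j _ => dseq_le hq hp1 hp2 k hk2 hs j)).trans (hU i))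
  have hupp : wlim q p1 p2 k (k+1) ≤ 1 / (c0 * (T/4)) := by
    refine wlim_upper hq hp1 hp2 hsum k hk2 M _ (by positivity) ?_
    refine (mul_le_mul_of_nonneg_left hM hc0pos.le).trans ?_
    rw [Finset.mul_sum]
    refine Finset.sum_le_sum (fun j _ => le_dseq hq hp1 hp2 k hk2 hs c0 hc0pos (min_le_left _ _)
      ((min_le_right _ _).trans (hN (k+1) (by omega)).2.2.2.1.le) j)
  have hqk := hq k hk2
  have hq1 : q k ≤ 1 := by linarith [hsum k hk2, hp1 k hk2, hp2 k hk2]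
  have hq2 : 1/(a+2) ≤ q k := by
    have := (hN k hk).2.2.2.2.1
    rw [div_lt_iff₀ hqk] at this
    rw [div_le_iff₀ (by positivity)]
    linarith [hsum k hk2]
  have hw := wlim_nonneg hq hp1 hp2 hsum k (k+1)
  constructor
  · calc 1/(a+2) * (1/2) * (1/T) = 1/(a+2) * (1/(2*T)) := by field_simp
      _ ≤ _ := by gcongr
  · calc q k * wlim q p1 p2 k (k+1) ≤ 1 * (1 / (c0 * (T/4))) := by gcongr
      _ = _ := by field_simp

end det2

section final

/-- `log n / (log log n)^β` -/
def tt (β : ℝ) (n : ℕ) : ℝ := Real.log (n:ℝ) / ell β n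

lemma tt_step {β : ℝ} {n : ℕ} (h : EllFacts β n) :
    tt β n + (1/2) * (1 / (((n+1:ℕ):ℝ) * ell β (n+1))) ≤ tt β (n+1) ∧
    tt β (n+1) ≤ tt β n + 2 * (1 / (((n+1:ℕ):ℝ) * ell β (n+1))) := by
  have hu := log_succ_sub_le n (by have := h.npos; omega)
  have hv := le_log_succ_sub n (by have := h.npos; omega)
  obtain ⟨h4, h1, hm, hi, hx, hx4, hxl⟩ := h
  unfold tt
  push_cast at hu hv ⊢
  have hn4 : (4:ℝ) ≤ n := by exact_mod_cast h4
  have hn : (0:ℝ) < n := by linarith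
  set L := Real.log (n:ℝ)
  set L' := Real.log ((n:ℝ)+1)
  set x := Real.log L
  set l := ell β n
  set l' := ell β (n+1)
  have hL : 0 < L := by linarith
  have hl : 0 < l := by linarith
  have hl' : 0 < l' := by linarith
  have hd0 : 0 ≤ L * (l' - l) := mul_nonneg hL.le (by linarith)
  have hd : 4 * (n * (L * (l' - l))) ≤ l := by
    have : 4 * (n * (L * (l' - l))) ≤ x * (n * (L * (l' - l))) :=
      mul_le_mul_of_nonneg_right hx4 (mul_nonneg hn.le hd0)
    linarith
  have hd' : L * (l' - l) ≤ l / (4 * n) := by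
    rw [le_div_iff₀ (by positivity)]; linarith
  have e : L' / l' - L / l = ((L' - L) * l - L * (l' - l)) / (l * l') := by
    field_simp; ring
  have e1 : (1/2) * (1 / (((n:ℝ)+1) * l')) = (l / (2 * ((n:ℝ)+1))) / (l * l') := by
    field_simp
  have e2 : 2 * (1 / (((n:ℝ)+1) * l')) = (2 * l / ((n:ℝ)+1)) / (l * l') := by
    field_simp
  have b1 : l / (2 * ((n:ℝ)+1)) ≤ (L' - L) * l - L * (l' - l) := by
    have : 1/((n:ℝ)+1) * l ≤ (L' - L) * l := mul_le_mul_of_nonneg_right hv hl.le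
    have h3 : l / (4 * n) ≤ l / (2 * ((n:ℝ)+1)) := by gcongr l / ?_; linarith
    have h5 : l / (2 * ((n:ℝ)+1)) + l / (2 * ((n:ℝ)+1)) = 1/((n:ℝ)+1) * l := by field_simp; ring
    linarith
  have b2 : (L' - L) * l - L * (l' - l) ≤ 2 * l / ((n:ℝ)+1) := by
    have h3 : (L' - L) * l ≤ 1 / n * l := mul_le_mul_of_nonneg_right hu hl.le
    have h5 : 1 / n * l ≤ 2 * l / ((n:ℝ)+1) := by
      rw [div_mul_eq_mul_div, div_le_div_iff₀ hn (by positivity)]; nlinarith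
    linarith
  have hll : 0 < l * l' := by positivity
  constructor
  · have : (l / (2 * ((n:ℝ)+1))) / (l * l') ≤ ((L' - L) * l - L * (l' - l)) / (l * l') := by gcongr
    linarith
  · have : ((L' - L) * l - L * (l' - l)) / (l * l') ≤ (2 * l / ((n:ℝ)+1)) / (l * l') := by gcongr
    linarith

lemma tt_tendsto {β : ℝ} (hβ0 : 0 ≤ β) (hβ1 : β < 1) : Tendsto (tt β) atTop atTop := by
  rw [tendsto_atTop]
  intro M
  have h1 := Real.isLittleO_log_id_atTop.bound (show (0:ℝ) < 1/(|M|+1) by positivity)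
  have h1 := tendsto_lognat.eventually h1
  filter_upwards [h1, ell_facts hβ0 hβ1] with n hn hf
  have hL : 0 ≤ Real.log (n:ℝ) := by linarith [hf.four, hf.xlog]
  have hx : 0 ≤ Real.log (Real.log (n:ℝ)) := by linarith [hf.four]
  simp only [id, Real.norm_eq_abs, abs_of_nonneg hL, abs_of_nonneg hx] at hn
  unfold tt
  have hl : 0 < ell β n := by linarith [hf.one_le]
  rw [le_div_iff₀ hl]
  have h2 : ell β n ≤ 1/(|M|+1) * Real.log n := hf.le_x.trans hn
  calc M * ell β n ≤ (|M|+1) * ell β n := by gcongr; linarith [le_abs_self M]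
    _ ≤ (|M|+1) * (1/(|M|+1) * Real.log n) := by gcongr
    _ = _ := by field_simp

lemma SX_eq (ω : ℕ → ℕ) (n : ℕ) :
    (SX ω n : ℝ) = ∑ k ∈ Finset.Icc 2 n, (cutSet k).indicator (fun _ => (1:ℝ)) ω := by
  classical
  have : {k : ℕ | 2 ≤ k ∧ k ≤ n ∧ (∃! m, ω m = k)}
      = ((Finset.Icc 2 n).filter (fun k => ω ∈ cutSet k) : Finset ℕ) := by
    ext k
    rw [Finset.mem_coe, Finset.mem_filter, Finset.mem_Icc, and_assoc]
    rfl
  unfold SX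
  rw [this, Set.ncard_coe_finset, Finset.card_filter]
  push_cast
  refine Finset.sum_congr rfl (fun k _ => ?_)
  simp [Set.indicator_apply]

lemma SX_mono (ω : ℕ → ℕ) : Monotone (SX ω) := by
  intro n m h
  unfold SX
  apply Set.ncard_le_ncard
  · rintro k ⟨h1, h2, h3⟩; exact ⟨h1, h2.trans h, h3⟩
  · exact (Set.finite_Icc 2 m).subset (fun k hk => ⟨hk.1, hk.2.1⟩)

variable {μ : Measure (ℕ → ℕ)}

lemma SX_integrable [IsProbabilityMeasure μ] (n : ℕ) :
    Integrable (fun ω => (SX ω n : ℝ)) μ := by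
  simp_rw [SX_eq]
  exact integrable_finsetSum _ (fun k _ => (integrable_const _).indicator (cutSet_meas k))

lemma SX_integral [IsProbabilityMeasure μ] (n : ℕ) :
    ∫ ω, (SX ω n : ℝ) ∂μ = ∑ k ∈ Finset.Icc 2 n, μ.real (cutSet k) := by
  simp_rw [SX_eq]
  rw [integral_finsetSum _ (fun k _ => (integrable_const _).indicator (cutSet_meas k))]
  refine Finset.sum_congr rfl (fun k _ => ?_)
  rw [integral_indicator (cutSet_meas k)]
  simp

lemma ES_bounds {u : ℕ → ℝ} {β : ℝ} (hβ0 : 0 ≤ β) (hβ1 : β < 1) {c C : ℝ} (hc : 0 < c)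
    (hC : 0 < C) (hu0 : ∀ k, 0 ≤ u k)
    (hu : ∀ᶠ k : ℕ in atTop, c * (1 / (k * ell β k)) ≤ u k ∧ u k ≤ C * (1 / (k * ell β k))) :
    ∀ᶠ n : ℕ in atTop, (c/4) * tt β n ≤ ∑ k ∈ Finset.Icc 2 n, u k ∧
      ∑ k ∈ Finset.Icc 2 n, u k ≤ (2 * C + 1) * tt β n := by
  obtain ⟨N, hN⟩ := eventually_atTop.1 (hu.and (ell_facts hβ0 hβ1))
  set E : ℕ → ℝ := fun n => ∑ k ∈ Finset.Icc 2 n, u k with hE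
  have hE0 : ∀ n, 0 ≤ E n := fun n => Finset.sum_nonneg (fun k _ => hu0 k)
  have key : ∀ n, N ≤ n → E N + (c/2) * (tt β n - tt β N) ≤ E n ∧
      E n ≤ E N + 2 * C * (tt β n - tt β N) := by
    intro n hn
    induction n, hn using Nat.le_induction with
    | base => simp
    | succ n hn ih =>
      have F := (hN n hn).2
      have h4 := F.npos
      have es : E (n+1) = E n + u (n+1) := Finset.sum_Icc_succ_top (by omega) u
      obtain ⟨t1, t2⟩ := tt_step F
      obtain ⟨u1, u2⟩ := (hN (n+1) (by omega)).1
      set z := 1 / (((n+1:ℕ):ℝ) * ell β (n+1))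
      rw [es]
      constructor
      · nlinarith [ih.1]
      · nlinarith [ih.2]
  have hT := tt_tendsto hβ0 hβ1
  filter_upwards [eventually_ge_atTop N, hT.eventually_ge_atTop (E N),
    hT.eventually_ge_atTop (2 * tt β N), hT.eventually_ge_atTop 0] with n hn h1 h2 h3
  have hk := key n hn
  have htN : 0 ≤ tt β N := by
    have F := (hN N le_rfl).2
    have : 0 ≤ ell β N := by linarith [F.one_le]
    exact div_nonneg (by linarith [F.four, F.xlog]) this
  constructor
  · nlinarith [hk.1, hE0 N]
  · nlinarith [hk.2]

lemma ae_tendsto_zero {f : ℕ → (ℕ → ℕ) → ℝ} (hf0 : ∀ j ω, 0 ≤ f j ω)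
    (hfi : ∀ j, Integrable (f j) μ) {b : ℕ → ℝ} (hb : ∀ j, ∫ ω, f j ω ∂μ ≤ b j)
    (hbs : Summable b) : ∀ᵐ ω ∂μ, Tendsto (fun j => f j ω) atTop (𝓝 0) := by
  have h1 : ∫⁻ ω, ∑' j, ENNReal.ofReal (f j ω) ∂μ ≠ ⊤ := by
    rw [lintegral_tsum (fun j => (hfi j).aestronglyMeasurable.aemeasurable.ennreal_ofReal)]
    have e : ∀ j, ∫⁻ ω, ENNReal.ofReal (f j ω) ∂μ = ENNReal.ofReal (∫ ω, f j ω ∂μ) := fun j =>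
      (ofReal_integral_eq_lintegral_ofReal (hfi j) (Eventually.of_forall (hf0 j))).symm
    simp_rw [e]
    refine ne_top_of_le_ne_top hbs.tsum_ofReal_ne_top ?_
    exact ENNReal.tsum_le_tsum (fun j => ENNReal.ofReal_le_ofReal (hb j))
  have h2 := ae_lt_top' (AEMeasurable.tsum
    (fun j => (hfi j).aestronglyMeasurable.aemeasurable.ennreal_ofReal)) h1
  filter_upwards [h2] with ω hω
  have h3 := ENNReal.tendsto_atTop_zero_of_tsum_ne_top hω.ne
  have h4 := (ENNReal.tendsto_toReal ENNReal.zero_ne_top).comp h3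
  simp only [ENNReal.toReal_zero] at h4
  refine h4.congr (fun j => ?_)
  simp [ENNReal.toReal_ofReal (hf0 j ω)]

lemma tendsto_natlog : Tendsto (fun n => Nat.log 2 n) atTop atTop := by
  rw [tendsto_atTop]
  intro b
  filter_upwards [eventually_ge_atTop (2^b)] with n hn
  exact Nat.le_log_of_pow_le (by norm_num) hn

lemma interp {S : ℕ → ℕ} (hS : Monotone S) {D : ℕ → ℝ} {N : ℕ}
    (hDpos : ∀ n, N ≤ n → 0 < D n) (hDmono : ∀ n m, N ≤ n → n ≤ m → D n ≤ D m) {M : ℝ}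
    (hM : ∀ j, N ≤ j → D (2^(2^(j+1))) ≤ M * D (2^(2^j)))
    (h : Tendsto (fun j => (S (2^(2^j)) : ℝ) / D (2^(2^j))) atTop (𝓝 0)) :
    Tendsto (fun n => (S n : ℝ) / D n) atTop (𝓝 0) := by
  have hj : Tendsto (fun n => Nat.log 2 (Nat.log 2 n)) atTop atTop :=
    tendsto_natlog.comp tendsto_natlog
  have h1 := ((h.comp (tendsto_add_atTop_nat 1)).comp hj).const_mul M
  rw [mul_zero] at h1
  refine tendsto_of_tendsto_of_tendsto_of_le_of_le' tendsto_const_nhds h1 ?_ ?_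
  · filter_upwards [eventually_ge_atTop N] with n hn
    exact div_nonneg (by positivity) (hDpos n hn).le
  · filter_upwards [eventually_ge_atTop N, hj.eventually_ge_atTop N,
      tendsto_natlog.eventually_ge_atTop 1, eventually_ge_atTop 1] with n hn hjn hl hn1
    simp only [Function.comp]
    set j := Nat.log 2 (Nat.log 2 n) with hjdef
    have a1 : 2^(2^j) ≤ n := by
      refine le_trans ?_ (Nat.pow_log_le_self 2 (by omega : n ≠ 0))
      exact Nat.pow_le_pow_right (by norm_num) (Nat.pow_log_le_self 2 (by omega))
    have a2 : n ≤ 2^(2^(j+1)) := by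
      refine (Nat.lt_pow_succ_log_self (by norm_num : 1 < 2) n).le.trans ?_
      exact Nat.pow_le_pow_right (by norm_num) (Nat.lt_pow_succ_log_self (by norm_num : 1 < 2) _)
    have a3 : N ≤ 2^(2^j) := by
      have := Nat.lt_two_pow_self (n := j)
      have := Nat.lt_two_pow_self (n := 2^j)
      omega
    have d1 := hDpos _ a3
    have d2 := hDmono _ _ a3 a1
    have d3 := hM j hjn
    have d4 := hDpos (2^(2^(j+1))) (a3.trans (a1.trans a2))
    have s1 : (S n : ℝ) ≤ S (2^(2^(j+1))) := by exact_mod_cast hS a2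
    calc (S n : ℝ) / D n ≤ (S (2^(2^(j+1))) : ℝ) / D (2^(2^j)) := by gcongr
      _ ≤ M * ((S (2^(2^(j+1))) : ℝ) / D (2^(2^(j+1)))) := by
        rw [← mul_div_assoc, div_le_div_iff₀ d1 d4]
        have : (0:ℝ) ≤ S (2^(2^(j+1))) := by positivity
        nlinarith

lemma part_two [IsProbabilityMeasure μ] {β : ℝ} (hβ0 : 0 ≤ β) (hβ1 : β < 1) {C : ℝ} (hC : 0 < C)
    (hES : ∀ᶠ n : ℕ in atTop, ∫ ω, (SX ω n : ℝ) ∂μ ≤ C * tt β n) (ε : ℝ) (hε : 0 < ε) :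
    ∀ᵐ ω ∂μ, Tendsto
        (fun n : ℕ => (SX ω n : ℝ)
          / (Real.log n ^ (1 + ε) * Real.log (Real.log n) ^ (-β)))
        atTop (𝓝 0) := by
  obtain ⟨N, hN⟩ := eventually_atTop.1 (hES.and (ell_facts hβ0 hβ1))
  set D : ℕ → ℝ := fun n => Real.log n ^ (1 + ε) * Real.log (Real.log n) ^ (-β) with hD
  have hLpos : ∀ n, N ≤ n → 0 < Real.log (n:ℝ) := fun n hn => by
    linarith [(hN n hn).2.four, (hN n hn).2.xlog]
  have hlpos : ∀ n, N ≤ n → 0 < ell β n := fun n hn => by linarith [(hN n hn).2.one_le]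
  have hD1 : ∀ n, N ≤ n → D n = Real.log n ^ (1 + ε) / ell β n := by
    intro n hn
    simp only [hD, ell]
    rw [Real.rpow_neg (by linarith [(hN n hn).2.four])]; rfl
  have hD2 : ∀ n, N ≤ n → D n = Real.log n ^ ε * tt β n := by
    intro n hn
    rw [hD1 n hn, Real.rpow_add (hLpos n hn), Real.rpow_one, tt]; ring
  have hDpos : ∀ n, N ≤ n → 0 < D n := by
    intro n hn
    have := hLpos n hn; have := hlpos n hn
    rw [hD1 n hn]; positivity
  have hlmono : ∀ n m, N ≤ n → n ≤ m → ell β n ≤ ell β m := by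
    intro n m hn hm
    induction m, hm using Nat.le_induction with
    | base => exact le_rfl
    | succ m hm ih => exact ih.trans (hN m (hn.trans hm)).2.mono
  have hDmono : ∀ n m, N ≤ n → n ≤ m → D n ≤ D m := by
    intro n m hn hm
    induction m, hm using Nat.le_induction with
    | base => exact le_rfl
    | succ m hm ih =>
      refine ih.trans ?_
      have hm' := hn.trans hm
      rw [hD2 m hm', hD2 (m+1) (by omega)]
      have h1 := (tt_step (hN m hm').2).1
      have hl1 := hlpos (m+1) (by omega)
      have : 0 ≤ 1 / (((m+1:ℕ):ℝ) * ell β (m+1)) := by positivity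
      have h2 : tt β m ≤ tt β (m+1) := by linarith
      have h3 : 0 ≤ tt β m := div_nonneg (hLpos m hm').le (hlpos m hm').le
      have h4 : Real.log (m:ℝ) ≤ Real.log ((m+1:ℕ):ℝ) := by
        apply Real.log_le_log
        · have := (hN m hm').2.npos
          exact_mod_cast (by omega : 0 < m)
        · push_cast; linarith
      have h5 := hLpos m hm'
      gcongr
  have hlogj : ∀ j : ℕ, Real.log ((2^(2^j) : ℕ) : ℝ) = 2^j * Real.log 2 := by
    intro j; push_cast; rw [Real.log_pow]; push_cast; ring
  have hbig : ∀ j, j ≤ 2^(2^j) := by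
    intro j
    have := Nat.lt_two_pow_self (n := j)
    have := Nat.lt_two_pow_self (n := 2^j)
    omega
  have hMj : ∀ j, N ≤ j → D (2^(2^(j+1))) ≤ (2:ℝ)^(1+ε) * D (2^(2^j)) := by
    intro j hj
    have a1 : N ≤ 2^(2^j) := hj.trans (hbig j)
    have a2 : 2^(2^j) ≤ 2^(2^(j+1)) :=
      Nat.pow_le_pow_right (by norm_num) (Nat.pow_le_pow_right (by norm_num) (by omega))
    rw [hD1 _ a1, hD1 _ (a1.trans a2), ← mul_div_assoc]
    have e : Real.log ((2^(2^(j+1)) : ℕ) : ℝ) = 2 * Real.log ((2^(2^j) : ℕ) : ℝ) := by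
      rw [hlogj, hlogj]; ring
    have p1 := hLpos _ a1
    have p2 := hlpos _ a1
    rw [e, Real.mul_rpow (by norm_num) p1.le]
    have := hlmono _ _ a1 a2
    gcongr
  have hlog2 : 0 < Real.log 2 := Real.log_pos (by norm_num)
  have hr : (2:ℝ)^(-ε) < 1 := Real.rpow_lt_one_of_one_lt_of_neg (by norm_num) (by linarith)
  have hae := ae_tendsto_zero (μ := μ)
    (f := fun j ω => (SX ω (2^(2^(j+N))) : ℝ) / D (2^(2^(j+N))))
    (b := fun j => C * Real.log 2 ^ (-ε) * (((2:ℝ)^(-ε))^(j+N)))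
    (fun j ω => div_nonneg (by positivity) (hDpos _ (le_trans (by omega) (hbig (j+N)))).le)
    (fun j => (SX_integrable _).div_const _)
    (by
      intro j
      have a1 : N ≤ 2^(2^(j+N)) := le_trans (by omega) (hbig (j+N))
      have hE := (hN _ a1).1
      have p1 := hLpos _ a1
      have p2 := hlpos _ a1
      have p3 := hDpos _ a1
      have p4 : 0 < tt β (2^(2^(j+N))) := div_pos p1 p2
      rw [integral_div, div_le_iff₀ p3]
      refine hE.trans (le_of_eq ?_)
      rw [hD2 _ a1, hlogj, Real.mul_rpow (by positivity) hlog2.le, Real.rpow_neg hlog2.le,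
        Real.rpow_neg (by norm_num), inv_pow, ← Real.rpow_natCast (((2:ℝ)^ε)),
        ← Real.rpow_natCast 2, ← Real.rpow_mul (by norm_num), ← Real.rpow_mul (by norm_num),
        mul_comm ε]
      have z1 : 0 < Real.log 2 ^ ε := by positivity
      have z2 : 0 < (2:ℝ) ^ (((j+N:ℕ):ℝ) * ε) := by positivity
      field_simp)
    (by
      apply Summable.mul_left
      exact (summable_nat_add_iff N).2 (summable_geometric_of_lt_one (by positivity) hr))
  filter_upwards [hae] with ω hω
  exact interp (SX_mono ω) hDpos hDmono hMj ((tendsto_add_atTop_iff_nat N).1 hω)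

end final

theorem number_of_cutpoints_X
    (q p1 p2 : ℕ → ℝ)
    (hq : ∀ k, 2 ≤ k → 0 < q k) (hp1 : ∀ k, 2 ≤ k → 0 ≤ p1 k)
    (hp2 : ∀ k, 2 ≤ k → 0 < p2 k)
    (hsum : ∀ k, 2 ≤ k → q k + p1 k + p2 k = 1)
    (μ : Measure (ℕ → ℕ)) [IsProbabilityMeasure μ]
    (hμ : IsMarkovChain μ (transX q p1 p2) 2)
    (a b : ℝ) (ha : 0 < a) (hb : 0 < b)
    (hCa : Tendsto (fun k => (p1 k + p2 k) / q k) atTop (𝓝 a))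
    (hCb : Tendsto (fun k => p2 k / q k) atTop (𝓝 b))
    (β : ℝ) (hβ0 : 0 ≤ β) (hβ1 : β < 1)
    (hrho : (fun k => rho q p1 p2 k - (1 - 3 * rseq β k))
      =O[atTop] fun k => rseq β k ^ 2) :
    (∃ c₃ c₄ : ℝ, 0 < c₃ ∧ c₃ < c₄ ∧
      c₃ ≤ Filter.liminf
        (fun n : ℕ => (∫ ω, (SX ω n : ℝ) ∂μ)
          / (Real.log n * Real.log (Real.log n) ^ (-β))) atTop ∧
      Filter.limsup
        (fun n : ℕ => (∫ ω, (SX ω n : ℝ) ∂μ)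
          / (Real.log n * Real.log (Real.log n) ^ (-β))) atTop ≤ c₄) ∧
    (∀ ε : ℝ, 0 < ε →
      μ {ω | Tendsto
        (fun n : ℕ => (SX ω n : ℝ)
          / (Real.log n ^ (1 + ε) * Real.log (Real.log n) ^ (-β)))
        atTop (𝓝 0)} = 1) := by
  obtain ⟨c, C, hc, hC, hcut⟩ := cut_bounds hq hp1 hp2 hsum a ha hCa β hβ0 hβ1 hrho
  have hu : ∀ᶠ k : ℕ in atTop, c * (1 / (k * ell β k)) ≤ μ.real (cutSet k) ∧
      μ.real (cutSet k) ≤ C * (1 / (k * ell β k)) := by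
    filter_upwards [hcut, eventually_ge_atTop 2] with k hk hk2
    have : μ.real (cutSet k) = q k * wlim q p1 p2 k (k+1) := by
      rw [Measure.real, cut_prob hq hp1 hp2 hsum hμ k hk2, ENNReal.toReal_ofReal]
      exact mul_nonneg (hq k hk2).le (wlim_nonneg hq hp1 hp2 hsum k (k+1))
    rw [this]; exact hk
  have hES := ES_bounds hβ0 hβ1 hc hC (fun k => measureReal_nonneg) hu
  simp_rw [← SX_integral] at hES
  have hratio : ∀ᶠ n : ℕ in atTop, c/4 ≤ (∫ ω, (SX ω n : ℝ) ∂μ)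
      / (Real.log n * Real.log (Real.log n) ^ (-β)) ∧ (∫ ω, (SX ω n : ℝ) ∂μ)
      / (Real.log n * Real.log (Real.log n) ^ (-β)) ≤ 2 * C + 1 := by
    filter_upwards [hES, ell_facts hβ0 hβ1] with n hn hf
    have e : Real.log n * Real.log (Real.log n) ^ (-β) = tt β n := by
      rw [Real.rpow_neg (by linarith [hf.four])]; rfl
    have hp : 0 < tt β n := div_pos (by linarith [hf.four, hf.xlog]) (by linarith [hf.one_le])
    rw [e, le_div_iff₀ hp, div_le_iff₀ hp]
    exact hn
  refine ⟨⟨c/4, 2*C+1+c, by positivity, by linarith, ?_, ?_⟩, ?_⟩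
  · refine le_liminf_of_le ?_ (hratio.mono fun n h => h.1)
    exact IsBoundedUnder.isCoboundedUnder_ge ⟨2*C+1, eventually_map.2 (hratio.mono fun n h => h.2)⟩
  · refine limsup_le_of_le ?_ (hratio.mono fun n h => by linarith [h.2])
    exact IsBoundedUnder.isCoboundedUnder_le ⟨c/4, eventually_map.2 (hratio.mono fun n h => h.1)⟩
  · intro ε hε
    have h := part_two hβ0 hβ1 (by positivity) (hES.mono fun n h => h.2) ε hε
    refine le_antisymm prob_le_one ?_
    rw [← measure_univ (μ := μ)]
    exact measure_mono_ae (h.mono fun ω hω _ => hω)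

end
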